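/- arXiv:1511.08772 — 11 statements merged into one kernel-verified Lean document; each statement's English description precedes it below -/
import Mathlib

section
/- Let B and R be simple graphs on the same finite vertex set V such that G(B,R) is the complete graph on V. If B and R are both C4-free and C5-free, then V is obedient, i.e., there exist a clique X of B and a clique Y of R with V = X ∪ Y. -/
/-- A graph is `C4`-free: it has no induced cycle on four vertices. -/
def IsC4Free {V : Type*} (G : SimpleGraph V) : Prop :=
  ¬ ∃ a b c d : V, a ≠ c ∧ b ≠ d ∧
    G.Adj a b ∧ G.Adj b c ∧ G.Adj c d ∧ G.Adj d a ∧ ¬ G.Adj a c ∧ ¬ G.Adj b d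

/-- A graph is `C5`-free: it has no induced cycle on five vertices. -/
def IsC5Free {V : Type*} (G : SimpleGraph V) : Prop :=
  ¬ ∃ v : Fin 5 → V, Function.Injective v ∧
    (∀ i, G.Adj (v i) (v (i + 1))) ∧ (∀ i, ¬ G.Adj (v i) (v (i + 2)))

/-- A set `U` is obedient (w.r.t. `B` and `R`) if it is the union of a
`B`-clique and an `R`-clique. -/
def Obedient {V : Type*} (B R : SimpleGraph V) (U : Set V) : Prop :=
  ∃ X Y : Set V, B.IsClique X ∧ R.IsClique Y ∧ U = X ∪ Y

/-- Any two edges of the complement of a `C4`-free graph meet or are joined by an edge of the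
complement. -/
theorem IsC4Free.compl_adj_or {V : Type*} {G : SimpleGraph V} (hG : IsC4Free G) {a b c d : V}
    (hab : Gᶜ.Adj a b) (hcd : Gᶜ.Adj c d) :
    Gᶜ.Adj a c ∨ Gᶜ.Adj a d ∨ Gᶜ.Adj b c ∨ Gᶜ.Adj b d := by
  by_contra! h
  obtain ⟨hac, had, hbc, hbd⟩ := h
  have nac : a ≠ c := by rintro rfl; exact hbc hab.symm
  have nad : a ≠ d := by rintro rfl; exact hbd hab.symm
  have nbc : b ≠ c := by rintro rfl; exact hac hab
  have nbd : b ≠ d := by rintro rfl; exact had hab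
  simp only [SimpleGraph.compl_adj, not_and, not_not] at *
  exact hG ⟨a, c, b, d, hab.1, hcd.1, hac nac, (hbc nbc).symm, hbd nbd, (had nad).symm,
    hab.2, hcd.2⟩

theorem obedient_iff_compl {V : Type*} {B R : SimpleGraph V} {U : Set V} :
    Obedient B R U ↔ ∃ X Y : Set V, (∀ x ∈ X, ∀ y ∈ X, ¬ Bᶜ.Adj x y) ∧
      (∀ x ∈ Y, ∀ y ∈ Y, ¬ Rᶜ.Adj x y) ∧ U = X ∪ Y := by
  simp only [Obedient, SimpleGraph.isClique_iff, Set.Pairwise, SimpleGraph.compl_adj, not_and,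
    not_not]

theorem Obedient.symm {V : Type*} {B R : SimpleGraph V} {U : Set V} (h : Obedient B R U) :
    Obedient R B U := by
  obtain ⟨X, Y, hX, hY, rfl⟩ := h
  exact ⟨Y, X, hY, hX, Set.union_comm X Y⟩

theorem not_compl_adj_of_sup_eq_top {V : Type*} {B R : SimpleGraph V} (h : B ⊔ R = ⊤) {a b : V}
    (hB : Bᶜ.Adj a b) : ¬ Rᶜ.Adj a b := by
  intro hR
  have : (B ⊔ R).Adj a b := by rw [h]; exact hB.ne
  rw [SimpleGraph.compl_adj] at hB hR
  exact this.elim hB.2 hR.2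

/-- If the vertices of `U` that are `B`-nonadjacent to `v` form an `R`-clique, then obedience of `U`
extends to `insert v U`. -/
theorem Obedient.insert {V : Type*} {B R : SimpleGraph V} (hcomplete : B ⊔ R = ⊤)
    (hB4 : IsC4Free B) (hR4 : IsC4Free R) {U : Set V} {v : V} (hU : Obedient B R U)
    (hv : ∀ b ∈ U, ∀ c ∈ U, Bᶜ.Adj v b → Bᶜ.Adj v c → ¬ Rᶜ.Adj b c) :
    Obedient B R (insert v U) := by
  rw [obedient_iff_compl] at hU ⊢
  obtain ⟨X, Y, hX, hY, rfl⟩ := hU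
  have disj {a b : V} (h : Bᶜ.Adj a b) : ¬ Rᶜ.Adj a b :=
    not_compl_adj_of_sup_eq_top hcomplete h
  -- The vertices of `Y` that have to move to `X` when the non-neighbours of `v` move to `Y`.
  let M : Set V := {c | c ∈ Y ∧ ∃ b ∈ X, Bᶜ.Adj v b ∧ Rᶜ.Adj b c}
  have key {b c d : V} (hvb : Bᶜ.Adj v b) (hbc : Rᶜ.Adj b c) (hvc : ¬ Bᶜ.Adj v c)
      (hvd : ¬ Bᶜ.Adj v d) (hcd : Bᶜ.Adj c d) : Bᶜ.Adj b d := by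
    rcases hB4.compl_adj_or hvb hcd with h | h | h | h
    · exact absurd h hvc
    · exact absurd h hvd
    · exact absurd hbc (disj h)
    · exact h
  have hMv : ∀ c ∈ M, ¬ Bᶜ.Adj v c := by
    rintro c ⟨hc, b, hb, hvb, hbc⟩ hvc
    exact hv b (Or.inl hb) c (Or.inr hc) hvb hvc hbc
  have hMM : ∀ c ∈ M, ∀ d ∈ M, ¬ Bᶜ.Adj c d := by
    intro c hc d hd hcd
    have hvc := hMv c hc
    have hvd := hMv d hd
    obtain ⟨-, b, hb, hvb, hbc⟩ := hc
    obtain ⟨-, e, he, hve, hed⟩ := hd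
    have hbd := key hvb hbc hvc hvd hcd
    have hec := key hve hed hvd hvc hcd.symm
    rcases hR4.compl_adj_or hbc hed with h | h | h | h
    · exact hv b (Or.inl hb) e (Or.inl he) hvb hve h
    · exact disj hbd h
    · exact disj hec h.symm
    · exact disj hcd h
  have hMX : ∀ c ∈ M, ∀ d ∈ X, ¬ Bᶜ.Adj v d → ¬ Bᶜ.Adj c d := by
    intro c hc d hd hvd hcd
    have hvc := hMv c hc
    obtain ⟨-, b, hb, hvb, hbc⟩ := hc
    exact hX b hb d hd (key hvb hbc hvc hvd hcd)
  refine ⟨Insert.insert v ({x | x ∈ X ∧ ¬ Bᶜ.Adj v x} ∪ M),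
    {y | y ∈ Y ∧ y ∉ M} ∪ {x | x ∈ X ∧ Bᶜ.Adj v x}, ?_, ?_, ?_⟩
  · rintro x (rfl | ⟨hx, hvx⟩ | hx) y (rfl | ⟨hy, hvy⟩ | hy) h
    · exact h.ne rfl
    · exact hvy h
    · exact hMv y hy h
    · exact hvx h.symm
    · exact hX x hx y hy h
    · exact hMX y hy x hx hvx h.symm
    · exact hMv x hx h.symm
    · exact hMX x hx y hy hvy h
    · exact hMM x hx y hy h
  · rintro x (⟨hx, hxM⟩ | ⟨hx, hvx⟩) y (⟨hy, hyM⟩ | ⟨hy, hvy⟩) h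
    · exact hY x hx y hy h
    · exact hxM ⟨hx, y, hy, hvy, h.symm⟩
    · exact hyM ⟨hy, x, hx, hvx, h⟩
    · exact hv x (Or.inl hx) y (Or.inl hy) hvx hvy h
  · ext x
    have hM : x ∈ M → x ∈ Y := fun h => h.1
    simp only [Set.mem_insert_iff, Set.mem_union, Set.mem_ofPred_eq]
    tauto

/-- A vertex cannot have both an `R`-nonadjacent pair of `B`-non-neighbours and a `B`-nonadjacent
pair of `R`-non-neighbours. -/
theorem false_of_crossing_nonadjacent_pairs {V : Type*} {B R : SimpleGraph V}
    (hcomplete : B ⊔ R = ⊤) (hB4 : IsC4Free B) (hR4 : IsC4Free R) (hB5 : IsC5Free B)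
    {v b c e f : V} (hvb : Bᶜ.Adj v b) (hvc : Bᶜ.Adj v c) (hbc : Rᶜ.Adj b c)
    (hve : Rᶜ.Adj v e) (hvf : Rᶜ.Adj v f) (hef : Bᶜ.Adj e f) : False := by
  have disj {a b : V} (h : Bᶜ.Adj a b) : ¬ Rᶜ.Adj a b :=
    not_compl_adj_of_sup_eq_top hcomplete h
  have adj {a b : V} (h : Rᶜ.Adj a b) : B.Adj a b := by
    by_contra h'
    exact disj ((SimpleGraph.compl_adj _ _ _).2 ⟨h.ne, h'⟩) h
  -- In the remaining configuration the five vertices induce a cycle in `B`.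
  have cycle {b c e f : V} (hvb : Bᶜ.Adj v b) (hvc : Bᶜ.Adj v c) (hbc : Rᶜ.Adj b c)
      (hve : Rᶜ.Adj v e) (hvf : Rᶜ.Adj v f) (hef : Bᶜ.Adj e f) (hbe : Bᶜ.Adj b e)
      (hcf : Bᶜ.Adj c f) (hbf : Rᶜ.Adj b f) (hce : Rᶜ.Adj c e) : False := by
    refine hB5 ⟨![v, e, c, b, f], ?_, ?_, ?_⟩
    · have := hvb.ne
      have := hvc.ne
      have := hbc.ne
      have := hve.ne
      have := hvf.ne
      have := hef.ne
      have := hbe.ne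
      have := hcf.ne
      have := hbf.ne
      have := hce.ne
      intro i j hij
      fin_cases i <;> fin_cases j <;> simp_all
    · intro i
      fin_cases i
      · exact adj hve
      · exact adj hce.symm
      · exact adj hbc.symm
      · exact adj hbf
      · exact adj hvf.symm
    · intro i
      fin_cases i
      · exact hvc.2
      · exact hbe.symm.2
      · exact hcf.2
      · exact hvb.symm.2
      · exact hef.symm.2
  have h1 : Bᶜ.Adj b e ∨ Bᶜ.Adj b f := by
    rcases hB4.compl_adj_or hvb hef with h | h | h | h
    · exact absurd hve (disj h)
    · exact absurd hvf (disj h)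
    · exact Or.inl h
    · exact Or.inr h
  have h2 : Bᶜ.Adj c e ∨ Bᶜ.Adj c f := by
    rcases hB4.compl_adj_or hvc hef with h | h | h | h
    · exact absurd hve (disj h)
    · exact absurd hvf (disj h)
    · exact Or.inl h
    · exact Or.inr h
  have h3 : Rᶜ.Adj b e ∨ Rᶜ.Adj c e := by
    rcases hR4.compl_adj_or hve hbc with h | h | h | h
    · exact absurd h (disj hvb)
    · exact absurd h (disj hvc)
    · exact Or.inl h.symm
    · exact Or.inr h.symm
  have h4 : Rᶜ.Adj b f ∨ Rᶜ.Adj c f := by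
    rcases hR4.compl_adj_or hvf hbc with h | h | h | h
    · exact absurd h (disj hvb)
    · exact absurd h (disj hvc)
    · exact Or.inl h.symm
    · exact Or.inr h.symm
  rcases h1 with h1 | h1
  · have hce := h3.resolve_left (disj h1)
    have hcf := h2.resolve_left fun h => disj h hce
    exact cycle hvb hvc hbc hve hvf hef h1 hcf (h4.resolve_right (disj hcf)) hce
  · have hcf := h4.resolve_left (disj h1)
    have hce := h2.resolve_right fun h => disj h hcf
    exact cycle hvb hvc hbc hvf hve hef.symm h1 hce (h3.resolve_right (disj hce)) hcf

theorem stmt_0 {V : Type*} [Fintype V] (B R : SimpleGraph V)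
    (hcomplete : B ⊔ R = ⊤)
    (hB4 : IsC4Free B) (hR4 : IsC4Free R)
    (hB5 : IsC5Free B) (hR5 : IsC5Free R) :
    Obedient B R Set.univ := by
  induction (Set.univ : Set V), Set.finite_univ (α := V) using Set.Finite.induction_on with
  | empty => exact ⟨∅, ∅, by simp, by simp, by simp⟩
  | @insert v U _ _ ih =>
    by_cases h : ∀ b ∈ U, ∀ c ∈ U, Bᶜ.Adj v b → Bᶜ.Adj v c → ¬ Rᶜ.Adj b c
    · exact ih.insert hcomplete hB4 hR4 h
    · refine (ih.symm.insert (sup_comm B R ▸ hcomplete) hR4 hB4 fun e _ f _ hve hvf hef => ?_).symm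
      push Not at h
      obtain ⟨b, -, c, -, hvb, hvc, hbc⟩ := h
      exact false_of_crossing_nonadjacent_pairs hcomplete hB4 hR4 hB5 hvb hvc hbc hve hvf hef
end

section
/- Let B and R be simple graphs on the same finite vertex set V such that G(B,R) is the complete graph on V. If B is chordal (it has no induced cycle of length at least four) and R is C4-free, then V is obedient, i.e., there exist a clique X of B and a clique Y of R with V = X ∪ Y. -/
/-- A graph is chordal: it has no induced cycle of length at least four,
i.e. there is no `n ≥ 4` and injective cyclic sequence of `n` vertices in which
consecutive vertices are adjacent and non-consecutive vertices are non-adjacent. -/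
def IsChordal {V : Type*} (G : SimpleGraph V) : Prop :=
  ¬ ∃ n : ℕ, 4 ≤ n ∧ ∃ v : ZMod n → V, Function.Injective v ∧
    (∀ i, G.Adj (v i) (v (i + 1))) ∧
    (∀ i j : ZMod n, i ≠ j → j ≠ i + 1 → i ≠ j + 1 → ¬ G.Adj (v i) (v j))

namespace SimpleGraph

variable {V : Type*} {G : SimpleGraph V}

/-- Any two vertices of a connected graph are joined by an induced path. -/
lemma Connected.exists_induced_path (hG : G.Connected) (x y : V) :
    ∃ (n : ℕ) (p : ℕ → V), p 0 = x ∧ p n = y ∧ (∀ i < n, G.Adj (p i) (p (i + 1))) ∧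
      (∀ i j, i < j → j ≤ n → p i ≠ p j) ∧
      ∀ i j, i + 1 < j → j ≤ n → ¬ G.Adj (p i) (p j) := by
  obtain ⟨w, hw⟩ := hG.exists_walk_length_eq_dist x y
  have key (i j : ℕ) (hj : j ≤ w.length) :
      w.length ≤ i + G.dist (w.getVert i) (w.getVert j) + (w.length - j) := by
    have h₁ : G.dist x (w.getVert i) ≤ i :=
      (dist_le (w.take i)).trans (by rw [Walk.take_length]; exact min_le_left _ _)
    have h₂ : G.dist (w.getVert j) y ≤ w.length - j :=
      (dist_le (w.drop j)).trans (by rw [Walk.drop_length])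
    have h₃ := hG.dist_triangle (u := x) (v := w.getVert i) (w := y)
    have h₄ := hG.dist_triangle (u := w.getVert i) (v := w.getVert j) (w := y)
    omega
  refine ⟨w.length, w.getVert, w.getVert_zero, w.getVert_length,
    fun i hi => w.adj_getVert_succ hi, fun i j hij hj h => ?_, fun i j hij hj h => ?_⟩
  · have := key i j hj
    rw [h, dist_self] at this
    omega
  · have := key i j hj
    rw [dist_eq_one_iff_adj.mpr h] at this
    omega

/-- Adding to a connected vertex set a neighbour of one of its members keeps it connected. -/
lemma connected_induce_insert {A : Set V} (hA : (G.induce A).Connected) {a x : V} (ha : a ∈ A)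
    (hax : G.Adj a x) : (G.induce (insert x A)).Connected := by
  have : insert x A = A ∪ {a, x} := by
    ext z
    simp only [Set.mem_insert_iff, Set.mem_union, Set.mem_singleton_iff]
    grind
  rw [this]
  exact induce_union_connected hA.preconnected (induce_pair_connected_of_adj hax).preconnected
    ⟨a, ha, by simp⟩

/-- If every nonempty finite vertex set contains a simplicial vertex, then any family of pairwise
touching cliques inside a finite vertex set is met by a single clique. -/
lemma exists_isClique_inter_nonempty
    (hs : ∀ W : Finset V, W.Nonempty → ∃ s ∈ W, G.IsClique {x | x ∈ W ∧ G.Adj s x})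
    (W : Finset V) (F : Set (Set V)) (hF : ∀ S ∈ F, S ⊆ W ∧ S.Nonempty ∧ G.IsClique S)
    (hT : ∀ S ∈ F, ∀ T ∈ F, ∃ a ∈ S, ∃ b ∈ T, a = b ∨ G.Adj a b) :
    ∃ K : Set V, G.IsClique K ∧ ∀ S ∈ F, (S ∩ K).Nonempty := by
  classical
  induction W using Finset.strongInduction generalizing F with
  | H W ih =>
    rcases W.eq_empty_or_nonempty with rfl | hW
    · refine ⟨∅, by simp, fun S hS => ?_⟩
      obtain ⟨hSW, ⟨a, ha⟩, -⟩ := hF S hS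
      simpa using hSW ha
    obtain ⟨s, hsW, hsim⟩ := hs W hW
    have hcl : G.IsClique (insert s {x | x ∈ W ∧ G.Adj s x}) :=
      hsim.insert fun b hb _ => hb.2
    by_cases hmeet : ∀ S ∈ F, (S ∩ insert s {x | x ∈ W ∧ G.Adj s x}).Nonempty
    · exact ⟨_, hcl, hmeet⟩
    push Not at hmeet
    obtain ⟨E, hE, hEs⟩ := hmeet
    have hmove : ∀ S ∈ F, s ∈ S → ∃ z ∈ S, z ≠ s ∧ G.Adj s z := by
      intro S hS hsS
      obtain ⟨hSW, -, hSc⟩ := hF S hS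
      have : ∃ z ∈ S, z ≠ s := by
        by_contra! hall
        obtain ⟨a, ha, b, hb, hab⟩ := hT S hS E hE
        rw [hall a ha] at hab
        refine Set.notMem_empty b (hEs ▸ ⟨hb, ?_⟩)
        rcases hab with rfl | hab
        · exact Set.mem_insert _ _
        · exact Set.mem_insert_of_mem _ ⟨(hF E hE).1 hb, hab⟩
      obtain ⟨z, hz, hzs⟩ := this
      exact ⟨z, hz, hzs, hSc hsS hz hzs.symm⟩
    have hnbr : ∀ z ∈ W, ∀ z' ∈ W, G.Adj s z → G.Adj s z' → z = z' ∨ G.Adj z z' := by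
      intro z hz z' hz' h h'
      by_cases hzz : z = z'
      · exact .inl hzz
      · exact .inr (hsim ⟨hz, h⟩ ⟨hz', h'⟩ hzz)
    obtain ⟨K, hK, hKF⟩ := ih (W.erase s) (Finset.erase_ssubset hsW) (Set.image (· \ {s}) F)
      (by
        rintro _ ⟨S, hS, rfl⟩
        obtain ⟨hSW, ⟨a, ha⟩, hSc⟩ := hF S hS
        refine ⟨fun z hz => Finset.mem_erase.mpr ⟨hz.2, hSW hz.1⟩, ?_, hSc.subset Set.sdiff_subset⟩
        by_cases has : a = s
        · obtain ⟨z, hz, hzs, -⟩ := hmove S hS (has ▸ ha)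
          exact ⟨z, hz, hzs⟩
        · exact ⟨a, ha, has⟩)
      (by
        rintro _ ⟨S, hS, rfl⟩ _ ⟨T, hT', rfl⟩
        obtain ⟨a, ha, b, hb, hab⟩ := hT S hS T hT'
        have hSW := (hF S hS).1
        have hTW := (hF T hT').1
        by_cases has : a = s
        · subst has
          obtain ⟨z, hz, hza, hadj⟩ := hmove S hS ha
          by_cases hba : b = a
          · subst hba
            obtain ⟨z', hz', hzb, hadj'⟩ := hmove T hT' hb
            exact ⟨z, ⟨hz, hza⟩, z', ⟨hz', hzb⟩, hnbr z (hSW hz) z' (hTW hz') hadj hadj'⟩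
          · exact ⟨z, ⟨hz, hza⟩, b, ⟨hb, hba⟩, hnbr z (hSW hz) b (hTW hb) hadj
              (hab.resolve_left (Ne.symm hba))⟩
        · by_cases hbs : b = s
          · subst hbs
            obtain ⟨z', hz', hzb, hadj'⟩ := hmove T hT' hb
            exact ⟨a, ⟨ha, has⟩, z', ⟨hz', hzb⟩, hnbr a (hSW ha) z' (hTW hz')
              (hab.resolve_left has).symm hadj'⟩
          · exact ⟨a, ⟨ha, has⟩, b, ⟨hb, hbs⟩, hab⟩)
    refine ⟨K, hK, fun S hS => ?_⟩
    exact (hKF _ ⟨S, hS, rfl⟩).mono (Set.inter_subset_inter_left _ Set.sdiff_subset)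

end SimpleGraph

namespace IsChordal

variable {V : Type*} {G : SimpleGraph V}

/-- In a chordal graph, an induced path of length at least two cannot be closed to an induced
cycle by a single vertex `d`. -/
lemma not_closed_induced_path (hG : IsChordal G) {n : ℕ} (hn : 2 ≤ n) {p : ℕ → V} {d : V}
    (hadj : ∀ i < n, G.Adj (p i) (p (i + 1))) (hinj : ∀ i j, i < j → j ≤ n → p i ≠ p j)
    (hind : ∀ i j, i + 1 < j → j ≤ n → ¬ G.Adj (p i) (p j))
    (h0 : G.Adj d (p 0)) (hend : G.Adj d (p n))
    (hd : ∀ i, 0 < i → i < n → d ≠ p i ∧ ¬ G.Adj (p i) d) : False := by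
  let q : ℕ → V := fun k => if k ≤ n then p k else d
  have qle {k : ℕ} (hk : k ≤ n) : q k = p k := if_pos hk
  have qlast : q (n + 1) = d := if_neg (by omega)
  have hlt (i : ZMod (n + 2)) : i.val < n + 2 := ZMod.val_lt i
  have h1 : (1 : ZMod (n + 2)).val = 1 := by
    simpa using ZMod.val_natCast_of_lt (n := n + 2) (a := 1) (by omega)
  have hval (i : ZMod (n + 2)) (hi : i.val ≤ n) : (i + 1).val = i.val + 1 := by
    rw [ZMod.val_add_of_lt (by omega), h1]
  have hval' (i : ZMod (n + 2)) (hi : i.val = n + 1) : (i + 1).val = 0 := by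
    rw [ZMod.val_add, h1, hi]
    simp
  have qne : ∀ i j, i < j → j < n + 2 → q i ≠ q j := by
    intro i j hij hj
    rcases Nat.lt_or_ge n j with h | h
    · obtain rfl : j = n + 1 := by omega
      rw [qlast, qle (by omega)]
      rcases Nat.eq_zero_or_pos i with rfl | hi
      · exact h0.ne'
      · rcases Nat.lt_or_ge i n with hin | hin
        · exact (hd i hi hin).1.symm
        · obtain rfl : i = n := by omega
          exact hend.ne'
    · rw [qle h, qle (by omega)]
      exact hinj i j hij h
  have qnadj : ∀ i j, i + 1 < j → j < n + 2 → ¬ (i = 0 ∧ j = n + 1) → ¬ G.Adj (q i) (q j) := by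
    intro i j hij hj hne
    rcases Nat.lt_or_ge n j with h | h
    · obtain rfl : j = n + 1 := by omega
      rw [qlast, qle (by omega)]
      exact (hd i (by omega) (by omega)).2
    · rw [qle h, qle (by omega)]
      exact hind i j hij h
  have hfar (i j : ZMod (n + 2)) (hij : i.val < j.val) (h₁ : j ≠ i + 1) (h₂ : i ≠ j + 1) :
      ¬ G.Adj (q i.val) (q j.val) := by
    have hj := hlt j
    have e₁ : j.val ≠ i.val + 1 := fun h =>
      h₁ (ZMod.val_injective _ (by rw [hval i (by omega), h]))
    refine qnadj _ _ (by omega) hj fun h => h₂ (ZMod.val_injective _ ?_)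
    rw [hval' j h.2, h.1]
  refine hG ⟨n + 2, by omega, fun i => q i.val, fun i j hij => ?_, fun i => ?_,
    fun i j hij h₁ h₂ => ?_⟩
  · apply ZMod.val_injective
    by_contra hne
    rcases Nat.lt_or_gt_of_ne hne with h | h
    · exact qne _ _ h (hlt j) hij
    · exact qne _ _ h (hlt i) hij.symm
  · have hi := hlt i
    dsimp only
    rcases Nat.lt_or_ge n i.val with h | h
    · have h' : i.val = n + 1 := by omega
      rw [hval' i h', h', qlast, qle (by omega)]
      exact h0
    · rw [hval i h, qle h]
      rcases Nat.lt_or_ge i.val n with h' | h'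
      · rw [qle (by omega)]
        exact hadj _ h'
      · have hin : i.val = n := by omega
        rw [hin, qlast]
        exact hend.symm
  · rcases Nat.lt_or_gt_of_ne (fun h => hij (ZMod.val_injective _ h)) with h | h
    · exact hfar i j h h₁ h₂
    · exact fun hadj' => hfar j i h h₂ h₁ hadj'.symm

/-- In a chordal graph, two neighbours of `d` which both have a neighbour in a connected set
not touching `d` are adjacent. -/
lemma adj_of_connected (hG : IsChordal G) {A : Set V} (hA : (G.induce A).Connected)
    {d x y a b : V} (hdA : d ∉ A) (hdn : ∀ a ∈ A, ¬ G.Adj a d) (hx : G.Adj d x) (hy : G.Adj d y)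
    (ha : a ∈ A) (hax : G.Adj a x) (hb : b ∈ A) (hby : G.Adj b y) (hxy : x ≠ y) :
    G.Adj x y := by
  by_contra hnadj
  have hC : (G.induce (insert y (insert x A))).Connected :=
    SimpleGraph.connected_induce_insert (SimpleGraph.connected_induce_insert hA ha hax)
      (Set.mem_insert_of_mem _ hb) hby
  obtain ⟨n, p, hp0, hpn, hadj, hinj, hind⟩ :=
    hC.exists_induced_path ⟨x, by simp⟩ ⟨y, by simp⟩
  have hp0' : (p 0 : V) = x := by rw [hp0]
  have hpn' : (p n : V) = y := by rw [hpn]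
  have hn : 2 ≤ n := by
    by_contra! hlt
    interval_cases n
    · exact hxy (hp0'.symm.trans hpn')
    · have h : G.Adj (p 0) (p 1) := hadj 0 (by omega)
      rw [hp0', hpn'] at h
      exact hnadj h
  refine hG.not_closed_induced_path (d := d) hn (p := fun i => (p i : V)) hadj
    (fun i j hij hj h => hinj i j hij hj (Subtype.ext h)) hind (by rwa [hp0']) (by rwa [hpn'])
    fun i hi hin => ?_
  have hmem : (p i : V) ∈ A := by
    rcases (p i).2 with h | h | h
    · exact absurd (Subtype.ext (h.trans hpn'.symm)) (hinj i n hin le_rfl)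
    · exact absurd (Subtype.ext (hp0'.trans h.symm)) (hinj 0 i hi hin.le)
    · exact h
  exact ⟨fun h => hdA (h ▸ hmem), hdn _ hmem⟩

/-- Every nonempty finite vertex set of a chordal graph contains a simplicial vertex. -/
lemma exists_simplicial [Finite V] (hG : IsChordal G) (W : Finset V) (hW : W.Nonempty) :
    ∃ s ∈ W, G.IsClique {x | x ∈ W ∧ G.Adj s x} := by
  classical
  induction W using Finset.strongInduction with
  | H W ih =>
    by_cases hcl : G.IsClique (W : Set V)
    · obtain ⟨s, hs⟩ := hW
      exact ⟨s, hs, hcl.subset fun x hx => hx.1⟩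
    obtain ⟨v, hv, w, hw, hvw, hnvw⟩ : ∃ v ∈ W, ∃ w ∈ W, v ≠ w ∧ ¬ G.Adj v w := by
      by_contra! h
      exact hcl fun v hv w hw hvw => h v hv w hw hvw
    let P : Set (Set V) := {A | A ⊆ W ∧ (G.induce A).Connected ∧
      ∃ d ∈ W, d ∉ A ∧ ∀ a ∈ A, ¬ G.Adj a d}
    have hvP : {v} ∈ P := by
      refine ⟨by simpa using hv, ?_, w, hw, by simpa using hvw.symm, by simpa using hnvw⟩
      exact { preconnected := .of_subsingleton, nonempty := ⟨⟨v, rfl⟩⟩ }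
    obtain ⟨A, -, ⟨hAW, hA, d, hdW, hdA, hdn⟩, hmax⟩ := (Set.toFinite P).exists_le_maximal hvP
    let D := W.filter fun d => d ∉ A ∧ ∀ a ∈ A, ¬ G.Adj a d
    have hDW : D ⊂ W := by
      obtain ⟨a, ha⟩ := hA.nonempty
      exact Finset.filter_ssubset.mpr ⟨a, hAW ha, fun h => h.1 ha⟩
    obtain ⟨s, hs, hsim⟩ := ih D hDW ⟨d, Finset.mem_filter.mpr ⟨hdW, hdA, hdn⟩⟩
    obtain ⟨hsW, hsA, hsn⟩ := Finset.mem_filter.mp hs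
    have hbd : ∀ x ∈ W, G.Adj s x → x ∉ D → ∃ a ∈ A, G.Adj a x := by
      intro x hx hsx hxD
      by_contra! h
      exact hxD (Finset.mem_filter.mpr ⟨hx, fun hxA => hsn x hxA hsx.symm, h⟩)
    have hfull : ∀ x ∈ W, G.Adj s x → x ∉ D → ∀ y ∈ D, x ≠ y → G.Adj x y := by
      intro x hx hsx hxD y hy hxy
      obtain ⟨a, ha, hax⟩ := hbd x hx hsx hxD
      obtain ⟨hyW, hyA, hyn⟩ := Finset.mem_filter.mp hy
      by_contra hnadj
      have hxP : insert x A ∈ P := by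
        refine ⟨Set.insert_subset hx hAW, SimpleGraph.connected_induce_insert hA ha hax,
          y, hyW, ?_, ?_⟩
        · rintro (h | h)
          exacts [hxy h.symm, hyA h]
        · rintro b (rfl | hb)
          exacts [hnadj, hyn b hb]
      exact hsn x (hmax hxP (Set.subset_insert _ _) (Set.mem_insert _ _)) hsx.symm
    refine ⟨s, hsW, ?_⟩
    rintro x ⟨hx, hsx⟩ y ⟨hy, hsy⟩ hxy
    by_cases hxD : x ∈ D
    · by_cases hyD : y ∈ D
      · exact hsim ⟨hxD, hsx⟩ ⟨hyD, hsy⟩ hxy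
      · exact (hfull y hy hsy hyD x hxD hxy.symm).symm
    · by_cases hyD : y ∈ D
      · exact hfull x hx hsx hxD y hyD hxy
      · obtain ⟨a, ha, hax⟩ := hbd x hx hsx hxD
        obtain ⟨b, hb, hby⟩ := hbd y hy hsy hyD
        exact hG.adj_of_connected hA hsA hsn hsx hsy ha hax hb hby hxy

end IsChordal

theorem stmt_1 {V : Type*} [Fintype V] (B R : SimpleGraph V)
    (hcomplete : B ⊔ R = ⊤)
    (hBchordal : IsChordal B) (hR4 : IsC4Free R) :
    Obedient B R Set.univ := by
  have hBR : ∀ u v, u ≠ v → ¬ B.Adj u v → R.Adj u v := by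
    intro u v huv hB
    have h : (B ⊔ R).Adj u v := by rw [hcomplete]; exact huv
    exact h.resolve_left hB
  have hRB : ∀ u v, u ≠ v → ¬ R.Adj u v → B.Adj u v := by
    intro u v huv hR
    by_contra hB
    exact hR (hBR u v huv hB)
  -- The edges of `B` missing from `R` pairwise touch, since `R` is `C4`-free.
  obtain ⟨K, hK, hKF⟩ := SimpleGraph.exists_isClique_inter_nonempty
    (fun W hW => hBchordal.exists_simplicial W hW) Finset.univ
    {S | ∃ u v, u ≠ v ∧ ¬ R.Adj u v ∧ S = {u, v}}
    (by
      rintro _ ⟨u, v, huv, hR, rfl⟩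
      refine ⟨by simp, ⟨u, by simp⟩, ?_⟩
      rw [SimpleGraph.isClique_pair]
      exact fun _ => hRB u v huv hR)
    (by
      rintro _ ⟨u, v, huv, hR, rfl⟩ _ ⟨u', v', huv', hR', rfl⟩
      by_contra! h
      have key : ∀ a ∈ ({u, v} : Set V), ∀ b ∈ ({u', v'} : Set V), R.Adj a b :=
        fun a ha b hb => hBR a b (h a ha b hb).1 (h a ha b hb).2
      exact hR4 ⟨u, u', v, v', huv, huv', key u (by simp) u' (by simp),
        (key v (by simp) u' (by simp)).symm, key v (by simp) v' (by simp),
        (key u (by simp) v' (by simp)).symm, hR, hR'⟩)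
  refine ⟨K, Kᶜ, hK, fun u hu v hv huv => ?_, (Set.union_compl_self K).symm⟩
  by_contra hR
  obtain ⟨z, hz, hzK⟩ := hKF {u, v} ⟨u, v, huv, hR, rfl⟩
  rcases hz with rfl | rfl
  exacts [hu hzK, hv hzK]
end

section
/- Let B and R be simple graphs on the same finite vertex set V such that: B and R are C4-free; G(B,R) does not contain a double C5; G(B,R) is the complete graph on V; and every proper subset U ⊊ V is obedient. If there are distinct vertices v1, v2, v3, v4, v5 such that v1-v2-v3-v4-v5-v1 is an induced C5 in R (consecutive pairs R-adjacent, non-consecutive pairs R-non-adjacent) and the edges v1v2 and v3v4 are edges of R but not of B, then V is obedient. -/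
/-- `S` induces a cycle of length five in `G`. -/
def IsInducedC5On {V : Type*} (G : SimpleGraph V) (S : Set V) : Prop :=
  ∃ v : Fin 5 → V, Function.Injective v ∧ Set.range v = S ∧
    (∀ i, G.Adj (v i) (v (i + 1))) ∧ (∀ i, ¬ G.Adj (v i) (v (i + 2)))

/-- `G(B,R)` contains a double `C5`: a set of five vertices inducing a
cycle of length five in both `B` and `R`. -/
def HasDoubleC5 {V : Type*} (B R : SimpleGraph V) : Prop :=
  ∃ S : Set V, IsInducedC5On B S ∧ IsInducedC5On R S

theorem IsC4Free.adj_or_adj {V : Type*} {G : SimpleGraph V} (hG : IsC4Free G) {a b c d : V}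
    (hac : a ≠ c) (hbd : b ≠ d) (hab : G.Adj a b) (hbc : G.Adj b c) (hcd : G.Adj c d)
    (hda : G.Adj d a) : G.Adj a c ∨ G.Adj b d := by
  by_contra! h
  exact hG ⟨a, b, c, d, hac, hbd, hab, hbc, hcd, hda, h.1, h.2⟩

theorem isInducedC5On_of_adj {V : Type*} {G : SimpleGraph V} {a b c d e : V}
    (hinj : Function.Injective ![a, b, c, d, e])
    (hab : G.Adj a b) (hbc : G.Adj b c) (hcd : G.Adj c d) (hde : G.Adj d e) (hea : G.Adj e a)
    (hac : ¬ G.Adj a c) (hbd : ¬ G.Adj b d) (hce : ¬ G.Adj c e) (hda : ¬ G.Adj d a)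
    (heb : ¬ G.Adj e b) : IsInducedC5On G {a, b, c, d, e} := by
  refine ⟨![a, b, c, d, e], hinj, ?_, ?_, ?_⟩
  · ext z
    simp [eq_comm]
    tauto
  · intro i
    fin_cases i <;> assumption
  · intro i
    fin_cases i <;> assumption

/-- If `a-b-c-d-e-a` is an induced `C5` in `R` and `a-c-e-b-d-a` is an induced `C5` in `B`,
then there is a double `C5`. -/
theorem hasDoubleC5_of_adj {V : Type*} {B R : SimpleGraph V} {a b c d e : V}
    (hab : R.Adj a b) (hbc : R.Adj b c) (hcd : R.Adj c d) (hde : R.Adj d e) (hea : R.Adj e a)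
    (hac : ¬ R.Adj a c) (hbd : ¬ R.Adj b d) (hce : ¬ R.Adj c e) (hda : ¬ R.Adj d a)
    (heb : ¬ R.Adj e b)
    (hac' : B.Adj a c) (hce' : B.Adj c e) (heb' : B.Adj e b) (hbd' : B.Adj b d)
    (hda' : B.Adj d a)
    (hab' : ¬ B.Adj a b) (hbc' : ¬ B.Adj b c) (hcd' : ¬ B.Adj c d) (hde' : ¬ B.Adj d e)
    (hea' : ¬ B.Adj e a) : HasDoubleC5 B R := by
  have n1 := hab.ne
  have n2 := hbc.ne
  have n3 := hcd.ne
  have n4 := hde.ne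
  have n5 := hea.ne
  have n6 := hac'.ne
  have n7 := hce'.ne
  have n8 := heb'.ne
  have n9 := hbd'.ne
  have n10 := hda'.ne
  refine ⟨{a, b, c, d, e}, ?_, ?_⟩
  · have hset : ({a, b, c, d, e} : Set V) = {a, c, e, b, d} := by
      ext z
      simp only [Set.mem_insert_iff, Set.mem_singleton_iff]
      tauto
    rw [hset]
    refine isInducedC5On_of_adj ?_ hac' hce' heb' hbd' hda' (fun h => hea' h.symm)
      (fun h => hbc' h.symm) (fun h => hde' h.symm) (fun h => hab' h.symm) (fun h => hcd' h.symm)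
    intro i j hij
    fin_cases i <;> fin_cases j <;> simp_all
  · refine isInducedC5On_of_adj ?_ hab hbc hcd hde hea hac hbd hce hda heb
    intro i j hij
    fin_cases i <;> fin_cases j <;> simp_all

theorem stmt_4 {V : Type*} [Fintype V] (B R : SimpleGraph V)
    (hB4 : IsC4Free B) (hR4 : IsC4Free R)
    (hnoDouble : ¬ HasDoubleC5 B R)
    (hcomplete : B ⊔ R = ⊤)
    (hproper : ∀ U : Set V, U ⊂ Set.univ → Obedient B R U)
    (v₁ v₂ v₃ v₄ v₅ : V)
    (hdist : [v₁, v₂, v₃, v₄, v₅].Pairwise (· ≠ ·))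
    (h12 : R.Adj v₁ v₂) (h23 : R.Adj v₂ v₃) (h34 : R.Adj v₃ v₄)
    (h45 : R.Adj v₄ v₅) (h51 : R.Adj v₅ v₁)
    (h13 : ¬ R.Adj v₁ v₃) (h24 : ¬ R.Adj v₂ v₄) (h35 : ¬ R.Adj v₃ v₅)
    (h41 : ¬ R.Adj v₄ v₁) (h52 : ¬ R.Adj v₅ v₂)
    (hb12 : ¬ B.Adj v₁ v₂) (hb34 : ¬ B.Adj v₃ v₄) :
    Obedient B R Set.univ := by
  have hBR : ∀ {a b : V}, a ≠ b → ¬ R.Adj a b → B.Adj a b := fun {a b} hne h => by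
    have : (B ⊔ R).Adj a b := by rw [hcomplete]; exact hne
    exact this.resolve_right h
  have hRB : ∀ {a b : V}, a ≠ b → ¬ B.Adj a b → R.Adj a b := fun hne h => by
    by_contra h'
    exact h (hBR hne h')
  simp only [List.pairwise_cons, List.mem_cons, List.not_mem_nil, or_false, forall_eq_or_imp,
    forall_eq, ne_eq] at hdist
  obtain ⟨⟨-, n13, n14, -⟩, ⟨-, n24, n25⟩, ⟨-, n35⟩, -⟩ := hdist
  have b13 : B.Adj v₁ v₃ := hBR n13 h13
  have b24 : B.Adj v₂ v₄ := hBR n24 h24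
  have b35 : B.Adj v₃ v₅ := hBR n35 h35
  have b41 : B.Adj v₄ v₁ := hBR (Ne.symm n14) h41
  have b52 : B.Adj v₅ v₂ := hBR (Ne.symm n25) h52
  have hb23 : ¬ B.Adj v₂ v₃ := fun h =>
    (hB4.adj_or_adj h12.ne h34.ne b13 h.symm b24 b41).elim hb12 hb34
  -- The absence of a double `C5` forces both `v₄v₅` and `v₅v₁` into `B`.
  have b51_of_b45 : B.Adj v₄ v₅ → B.Adj v₅ v₁ := fun h =>
    (hB4.adj_or_adj h51.ne h34.ne b35.symm b13.symm b41.symm h).resolve_right hb34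
  have b45_of_b51 : B.Adj v₅ v₁ → B.Adj v₄ v₅ := fun h =>
    (hB4.adj_or_adj h45.ne h12.ne b41 h.symm b52 b24).resolve_right hb12
  have b51 : B.Adj v₅ v₁ := by
    by_contra h
    exact hnoDouble (hasDoubleC5_of_adj h12 h23 h34 h45 h51 h13 h24 h35 h41 h52
      b13 b35 b52 b24 b41 hb12 hb23 hb34 (fun h' => h (b51_of_b45 h')) h)
  have b45 : B.Adj v₄ v₅ := b45_of_b51 b51
  obtain ⟨X, Y, hX, hY, hXY⟩ := hproper {v₅}ᶜ
    (Set.ssubset_univ_iff.mpr fun h => by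
      have : v₅ ∈ ({v₅}ᶜ : Set V) := h ▸ Set.mem_univ v₅
      exact this rfl)
  have hcover : ∀ z, z ≠ v₅ → z ∈ X ∨ z ∈ Y := fun z hz => by
    have : z ∈ X ∪ Y := hXY ▸ hz
    exact this
  have hX5 : ∀ z ∈ X, z ≠ v₅ := fun z hz => by
    have : z ∈ ({v₅}ᶜ : Set V) := hXY ▸ Or.inl hz
    exact this
  have hY5 : ∀ z ∈ Y, z ≠ v₅ := fun z hz => by
    have : z ∈ ({v₅}ᶜ : Set V) := hXY ▸ Or.inr hz
    exact this
  have notX : ∀ {a b : V}, a ≠ b → ¬ B.Adj a b → a ∈ X → b ∉ X :=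
    fun hne h ha hb => h (hX ha hb hne)
  have notY : ∀ {a b : V}, a ≠ b → ¬ R.Adj a b → a ∈ Y → b ∉ Y :=
    fun hne h ha hb => h (hY ha hb hne)
  have m1 : v₁ ∈ X := by
    by_contra h
    have h3 : v₃ ∈ X :=
      (hcover v₃ n35).resolve_right (notY n13 h13 ((hcover v₁ h51.ne.symm).resolve_left h))
    exact notY n24 h24
      ((hcover v₂ n25).resolve_left fun h2 => notX h23.ne hb23 h2 h3)
      ((hcover v₄ h45.ne).resolve_left (notX h34.ne hb34 h3))
  have m2 : v₂ ∈ Y := (hcover v₂ n25).resolve_left (notX h12.ne hb12 m1)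
  have m4 : v₄ ∈ X := (hcover v₄ h45.ne).resolve_right (notY n24 h24 m2)
  have m3 : v₃ ∈ Y := (hcover v₃ n35).resolve_left fun h3 => notX h34.ne hb34 h3 m4
  -- `P` has to leave `X` to make room for `v₅`, and then `Q` has to leave `Y`.
  set P : Set V := {x | x ∈ X ∧ ¬ B.Adj x v₅}
  set Q : Set V := {y | y ∈ Y ∧ ∃ x ∈ P, x ≠ y ∧ ¬ R.Adj x y}
  have hPR : ∀ x ∈ P, R.Adj x v₁ ∧ R.Adj x v₂ ∧ R.Adj x v₃ ∧ R.Adj x v₄ ∧ R.Adj x v₅ := by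
    rintro x ⟨hx, hx5⟩
    have e1 : x ≠ v₁ := fun h => hx5 (h ▸ b51.symm)
    have e2 : x ≠ v₂ := fun h => hx5 (h ▸ b52.symm)
    have e3 : x ≠ v₃ := fun h => hx5 (h ▸ b35)
    have e4 : x ≠ v₄ := fun h => hx5 (h ▸ b45)
    have e5 := hX5 x hx
    have r5 : R.Adj x v₅ := hRB e5 hx5
    have r2 : R.Adj x v₂ := hRB e2 fun h =>
      (hB4.adj_or_adj e5 h12.ne (hX hx m1 e1) b51.symm b52 h.symm).elim hx5 hb12
    have r3 : R.Adj x v₃ := hRB e3 fun h =>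
      (hB4.adj_or_adj e5 h34.ne h b35 b45.symm (hX m4 hx e4.symm)).elim hx5 hb34
    have r1 := (hR4.adj_or_adj e1 (Ne.symm n25) r5 h51 h12 r2.symm).resolve_right h52
    have r4 := (hR4.adj_or_adj e4 n35 r3 h34 h45 r5.symm).resolve_right h35
    exact ⟨r1, r2, r3, r4, r5⟩
  have hPP : R.IsClique P := by
    intro x hx x' hx' hne
    obtain ⟨r1, -, r3, -, -⟩ := hPR x hx
    obtain ⟨s1, -, s3, -, -⟩ := hPR x' hx'
    exact (hR4.adj_or_adj hne n13 r1 s1.symm s3 r3.symm).resolve_right h13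
  have hQ5 : ∀ y ∈ Q, B.Adj y v₅ ∧ ¬ R.Adj y v₅ := by
    rintro y ⟨hy, x, hx, hne, hxy⟩
    obtain ⟨-, r2, -, -, r5⟩ := hPR x hx
    have e2 : y ≠ v₂ := fun h => hxy (h ▸ r2)
    have : ¬ R.Adj y v₅ := fun h =>
      (hR4.adj_or_adj hne (Ne.symm n25) r5 h.symm (hY hy m2 e2) r2.symm).elim hxy h52
    exact ⟨hBR (hY5 y hy) this, this⟩
  have hQQ : B.IsClique Q := by
    intro y hy y' hy' hne
    by_contra hyy
    have r := hRB hne hyy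
    obtain ⟨b5, r5⟩ := hQ5 y hy
    obtain ⟨b5', r5'⟩ := hQ5 y' hy'
    obtain ⟨-, x, hx, hxne, hxy⟩ := hy
    obtain ⟨-, x', hx', hxne', hxy'⟩ := hy'
    have bxy := hBR hxne hxy
    have bxy' := hBR hxne' hxy'
    have key : ∀ z ∈ P, B.Adj z y → B.Adj z y' → False := fun z hz hzy hzy' =>
      (hB4.adj_or_adj (hX5 z hz.1) hne hzy b5 b5'.symm hzy'.symm).elim hz.2 hyy
    have e1 : x ≠ x' := fun h => key x hx bxy (h ▸ bxy')
    have e2 : x ≠ y' := fun h => hx.2 (h ▸ b5')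
    have e3 : x' ≠ y := fun h => hx'.2 (h ▸ b5)
    have t1 : R.Adj x y' := hRB e2 fun h => key x hx bxy h
    have t2 : R.Adj x' y := hRB e3 fun h => key x' hx' h bxy'
    exact (hR4.adj_or_adj hxne hxne'.symm t1 r.symm t2.symm (hPP hx' hx e1.symm)).elim
      hxy fun h => hxy' h.symm
  have hXQ : ∀ y ∈ Q, ∀ u ∈ X, u ∉ P → u ≠ y → B.Adj u y := by
    intro y hy u hu huP hne
    by_contra huy
    obtain ⟨b5, -⟩ := hQ5 y hy
    obtain ⟨-, x, hx, hxne, hxy⟩ := hy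
    have hu5 : B.Adj u v₅ := by
      by_contra h
      exact huP ⟨hu, h⟩
    have hux : u ≠ x := fun h => huP (h ▸ hx)
    exact (hB4.adj_or_adj hne (hX5 x hx.1) (hX hu hx.1 hux) (hBR hxne hxy) b5 hu5.symm).elim
      huy hx.2
  refine ⟨insert v₅ ((X \ P) ∪ Q), (Y \ Q) ∪ P, ?_, ?_, ?_⟩
  · have hsymm : Std.Symm B.Adj := ⟨fun _ _ h => h.symm⟩
    refine (SimpleGraph.isClique_insert ..).mpr ⟨(Set.pairwise_union_of_symm ..).mpr
      ⟨hX.subset Set.sdiff_subset, hQQ, fun u hu y hy hne => hXQ y hy u hu.1 hu.2 hne⟩, ?_⟩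
    rintro z (hz | hz) -
    · by_contra h
      exact hz.2 ⟨hz.1, fun h' => h h'.symm⟩
    · exact (hQ5 z hz).1.symm
  · have hsymm : Std.Symm R.Adj := ⟨fun _ _ h => h.symm⟩
    refine (Set.pairwise_union_of_symm ..).mpr
      ⟨hY.subset Set.sdiff_subset, hPP, fun u hu x hx hne => ?_⟩
    by_contra h
    exact hu.2 ⟨hu.1, x, hx, hne.symm, fun h' => h h'.symm⟩
  · ext z
    have := hcover z
    simp only [Set.mem_univ, Set.mem_union, Set.mem_insert_iff, Set.mem_sdiff, true_iff]
    tauto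
end

section
/- Let B and R be C4-free simple graphs on the same finite vertex set V, and assume that G(B,R) is the complete graph on V. If G(B,R) does not contain a double C5, then V is obedient, i.e., there exist a clique X of B and a clique Y of R with V = X ∪ Y. -/
namespace SimpleGraph

variable {V : Type*}

/-- A graph has no induced `2K₂`: any two edges share a vertex or are joined by an edge.
When they share a vertex the conclusion holds automatically. -/
def TwoEdgesMeet (G : SimpleGraph V) : Prop :=
  ∀ ⦃a b c d : V⦄, G.Adj a b → G.Adj c d →
    G.Adj a c ∨ G.Adj a d ∨ G.Adj b c ∨ G.Adj b d

lemma twoEdgesMeet_compl_of_isC4Free {G : SimpleGraph V} (hG : IsC4Free G) :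
    Gᶜ.TwoEdgesMeet := by
  intro a b c d hab hcd
  by_contra! h
  obtain ⟨h₁, h₂, h₃, h₄⟩ := h
  refine hG ⟨a, c, b, d, hab.ne, hcd.ne, ?_⟩
  simp only [compl_adj] at *
  have := G.adj_comm
  grind

/-- The vertices reachable from `v` by walks alternating between `Q` and `P` that start in `Q`
and end in `P`, such that every second vertex is `P`-adjacent to its second successor. -/
inductive AltReach (P Q : SimpleGraph V) (v : V) : V → Prop
  | base {d e : V} : Q.Adj v d → P.Adj d e → AltReach P Q v e
  | step {c d e : V} : AltReach P Q v c → Q.Adj c d → P.Adj d e → P.Adj c e → AltReach P Q v e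

/-- `A` and `C` form a partial partition into a `Q`-independent and a `P`-independent set that
already contains all vertices whose side is forced by it. -/
structure IsClosedPair (P Q : SimpleGraph V) (A C : Set V) : Prop where
  indep_left : ∀ a ∈ A, ∀ b ∈ A, ¬ Q.Adj a b
  indep_right : ∀ a ∈ C, ∀ b ∈ C, ¬ P.Adj a b
  closed_left : ∀ a ∈ A, ∀ b, Q.Adj a b → b ∈ C
  closed_right : ∀ a ∈ C, ∀ b, P.Adj a b → b ∈ A

lemma IsClosedPair.symm {P Q : SimpleGraph V} {A C : Set V} (h : IsClosedPair P Q A C) :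
    IsClosedPair Q P C A :=
  ⟨h.indep_right, h.indep_left, h.closed_right, h.closed_left⟩

section AltReach

variable {P Q : SimpleGraph V} {v : V}

lemma AltReach.not_adj_start (hQ : Q.TwoEdgesMeet) (hPQ : Disjoint P Q)
    (hv : ∀ a b, Q.Adj v a → Q.Adj v b → ¬ P.Adj a b) {e : V} (he : AltReach P Q v e) :
    ¬ Q.Adj v e := by
  have hd : ∀ a b, P.Adj a b → ¬ Q.Adj a b := fun a b => disjoint_left.1 hPQ a b
  induction he with
  | base h₁ h₂ => exact fun h => hv _ _ h₁ h h₂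
  | @step c d e _ h₁ h₂ h₃ ih =>
    intro h
    have := hQ h h₁
    grind [SimpleGraph.adj_comm]

lemma AltReach.closed (hP : P.TwoEdgesMeet) (hQ : Q.TwoEdgesMeet) (hPQ : Disjoint P Q)
    (hv : ∀ a b, Q.Adj v a → Q.Adj v b → ¬ P.Adj a b) {c d e : V} (hc : AltReach P Q v c)
    (hcd : Q.Adj c d) (hde : P.Adj d e) : AltReach P Q v e := by
  have hd : ∀ a b, P.Adj a b → ¬ Q.Adj a b := fun a b => disjoint_left.1 hPQ a b
  induction hc generalizing d e with
  | @base b c h₁ h₂ =>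
    have hc := not_adj_start hQ hPQ hv (.base h₁ h₂)
    rcases hQ h₁ hcd with h | h | h | h
    · exact absurd h hc
    · exact .base h hde
    · exact absurd h (hd _ _ h₂)
    · rcases hP h₂ hde with h' | h' | h' | h'
      · exact absurd h (hd _ _ h')
      · exact .base h₁ h'
      · exact absurd hcd (hd _ _ h')
      · exact .step (.base h₁ h₂) hcd hde h'
  | @step a b c ha h₁ h₂ h₃ ih =>
    rcases hQ h₁ hcd with h | h | h | h
    · exact absurd h (hd _ _ h₃)
    · exact ih h hde
    · exact absurd h (hd _ _ h₂)
    · rcases hP h₂ hde with h' | h' | h' | h'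
      · exact absurd h (hd _ _ h')
      · exact ih h₁ h'
      · exact absurd hcd (hd _ _ h')
      · exact .step (.step ha h₁ h₂ h₃) hcd hde h'

lemma AltReach.not_adj (hP : P.TwoEdgesMeet) (hQ : Q.TwoEdgesMeet) (hPQ : Disjoint P Q)
    (hv : ∀ a b, Q.Adj v a → Q.Adj v b → ¬ P.Adj a b) {c e : V} (hc : AltReach P Q v c)
    (he : AltReach P Q v e) : ¬ Q.Adj c e := by
  induction hc generalizing e with
  | base h₁ h₂ =>
    exact fun h => not_adj_start hQ hPQ hv (closed hP hQ hPQ hv he h.symm h₂.symm) h₁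
  | step _ h₁ h₂ _ ih =>
    exact fun h => ih (closed hP hQ hPQ hv he h.symm h₂.symm) h₁

end AltReach

lemma exists_isClosedPair_left {P Q : SimpleGraph V} (hP : P.TwoEdgesMeet)
    (hQ : Q.TwoEdgesMeet) (hPQ : Disjoint P Q) {v : V}
    (hv : ∀ a b, Q.Adj v a → Q.Adj v b → ¬ P.Adj a b) :
    ∃ A C : Set V, v ∈ A ∧ IsClosedPair P Q A C := by
  let A : Set V := {x | x = v ∨ AltReach P Q v x}
  have hA : ∀ a ∈ A, ∀ b ∈ A, ¬ Q.Adj a b := by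
    rintro a (rfl | ha) b (rfl | hb)
    · exact Q.irrefl
    · exact hb.not_adj_start hQ hPQ hv
    · exact fun h => ha.not_adj_start hQ hPQ hv h.symm
    · exact ha.not_adj hP hQ hPQ hv hb
  have hcl : ∀ a ∈ A, ∀ c b, Q.Adj a c → P.Adj c b → b ∈ A := by
    rintro a (rfl | ha) c b h₁ h₂
    · exact .inr (.base h₁ h₂)
    · exact .inr (ha.closed hP hQ hPQ hv h₁ h₂)
  refine ⟨A, {c | ∃ a ∈ A, Q.Adj a c}, .inl rfl, hA, ?_, fun a ha b h => ⟨a, ha, h⟩, ?_⟩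
  · rintro c ⟨a, ha, hac⟩ d ⟨b, hb, hbd⟩ h
    exact hA b hb d (hcl a ha c d hac h) hbd
  · rintro c ⟨a, ha, hac⟩ b h
    exact hcl a ha c b hac h

/-- If the side of every single vertex can be chosen consistently, then every finite set splits
into a `Q`-independent set and a `P`-independent set. -/
lemma exists_partition_of_isClosedPair {P Q : SimpleGraph V}
    (h : ∀ v, ∃ A C : Set V, (v ∈ A ∨ v ∈ C) ∧ IsClosedPair P Q A C) (S : Finset V) :
    ∃ X Y : Set V, (∀ a ∈ X, ∀ b ∈ X, ¬ Q.Adj a b) ∧ (∀ a ∈ Y, ∀ b ∈ Y, ¬ P.Adj a b) ∧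
      (S : Set V) = X ∪ Y := by
  classical
  induction S using Finset.strongInduction with
  | H S ih =>
    obtain rfl | ⟨v, hvS⟩ := S.eq_empty_or_nonempty
    · exact ⟨∅, ∅, by simp⟩
    obtain ⟨A, C, hv, hAC⟩ := h v
    obtain ⟨X, Y, hX, hY, hXY⟩ := ih (S.filter fun x => ¬ (x ∈ A ∨ x ∈ C))
      (Finset.filter_ssubset.2 ⟨v, hvS, not_not.2 hv⟩)
    have hmem : ∀ x, (x ∈ S ∧ ¬ (x ∈ A ∨ x ∈ C)) ↔ x ∈ X ∨ x ∈ Y := fun x => by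
      simpa using Set.ext_iff.1 hXY x
    obtain ⟨hA, hC, hAc, hCa⟩ := hAC
    refine ⟨X ∪ (A ∩ S), Y ∪ (C ∩ S), ?_, ?_, ?_⟩
    · rintro a (ha | ⟨ha, -⟩) b (hb | ⟨hb, -⟩) hab
      · exact hX a ha b hb hab
      · exact ((hmem a).2 (.inl ha)).2 (.inr (hAc b hb a hab.symm))
      · exact ((hmem b).2 (.inl hb)).2 (.inr (hAc a ha b hab))
      · exact hA a ha b hb hab
    · rintro a (ha | ⟨ha, -⟩) b (hb | ⟨hb, -⟩) hab
      · exact hY a ha b hb hab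
      · exact ((hmem a).2 (.inr ha)).2 (.inl (hCa b hb a hab.symm))
      · exact ((hmem b).2 (.inr hb)).2 (.inl (hCa a ha b hab))
      · exact hC a ha b hb hab
    · ext x
      have := hmem x
      simp only [Finset.mem_coe, Set.mem_union, Set.mem_inter_iff]
      tauto

lemma isInducedC5On_of_adj {G : SimpleGraph V} {a b c d e : V}
    (hab : G.Adj a b) (hbc : G.Adj b c) (hcd : G.Adj c d) (hde : G.Adj d e) (hea : G.Adj e a)
    (hac : ¬ G.Adj a c) (hbd : ¬ G.Adj b d) (hce : ¬ G.Adj c e) (hda : ¬ G.Adj d a)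
    (heb : ¬ G.Adj e b) : IsInducedC5On G {a, b, c, d, e} := by
  have := hab.ne
  have := hbc.ne
  have := hcd.ne
  have := hde.ne
  have := hea.ne
  refine ⟨![a, b, c, d, e], ?_, ?_, ?_, ?_⟩
  · have : a ≠ c := by rintro rfl; exact hda hcd.symm
    have : b ≠ d := by rintro rfl; exact heb hde.symm
    have : c ≠ e := by rintro rfl; exact hac hea.symm
    have : d ≠ a := by rintro rfl; exact hbd hab.symm
    have : e ≠ b := by rintro rfl; exact hce hbc.symm
    intro i j hij
    fin_cases i <;> fin_cases j <;> simp_all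
  · ext x
    simp only [Matrix.range_cons, Matrix.range_empty, Set.mem_union, Set.mem_insert_iff,
      Set.mem_singleton_iff, Set.mem_empty_iff_false, or_false]
  · intro i
    fin_cases i <;> assumption
  · intro i
    fin_cases i <;> assumption

/-- A vertex that is excluded from both sides of a partition lies in a double `C5`. -/
lemma hasDoubleC5_of_triangles {B R : SimpleGraph V} (hB : Bᶜ.TwoEdgesMeet)
    (hR : Rᶜ.TwoEdgesMeet) (hBR : Disjoint Rᶜ Bᶜ) {v a b c d : V}
    (hva : Bᶜ.Adj v a) (hvb : Bᶜ.Adj v b) (hab : Rᶜ.Adj a b)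
    (hvc : Rᶜ.Adj v c) (hvd : Rᶜ.Adj v d) (hcd : Bᶜ.Adj c d) : HasDoubleC5 B R := by
  have hdis : ∀ x y, Rᶜ.Adj x y → ¬ Bᶜ.Adj x y := fun x y => disjoint_left.1 hBR x y
  have hBad : ∀ x y, Rᶜ.Adj x y → B.Adj x y := fun x y h => by
    by_contra h'
    exact hdis x y h ((compl_adj _ _ _).2 ⟨h.ne, h'⟩)
  have hRad : ∀ x y, Bᶜ.Adj x y → R.Adj x y := fun x y h => by
    by_contra h'
    exact hdis x y ((compl_adj _ _ _).2 ⟨h.ne, h'⟩) h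
  have hBn : ∀ x y, Bᶜ.Adj x y → ¬ B.Adj x y := fun x y h => ((compl_adj _ _ _).1 h).2
  have hRn : ∀ x y, Rᶜ.Adj x y → ¬ R.Adj x y := fun x y h => ((compl_adj _ _ _).1 h).2
  have key : ∀ c d, Rᶜ.Adj v c → Rᶜ.Adj v d → Bᶜ.Adj c d → Rᶜ.Adj a c → HasDoubleC5 B R := by
    intro c d hvc hvd hcd hac
    have had : Bᶜ.Adj a d := by
      have := hB hva hcd
      grind
    have hbd : Rᶜ.Adj b d := by
      have := hR hab hvd
      grind [SimpleGraph.adj_comm]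
    have hbc : Bᶜ.Adj b c := by
      have := hB hvb hcd
      grind
    refine ⟨{v, c, a, b, d}, ?_, ?_⟩
    · exact isInducedC5On_of_adj (hBad _ _ hvc) (hBad _ _ hac.symm) (hBad _ _ hab)
        (hBad _ _ hbd) (hBad _ _ hvd.symm) (hBn _ _ hva) (hBn _ _ hbc.symm) (hBn _ _ had)
        (hBn _ _ hvb.symm) (hBn _ _ hcd.symm)
    · have : ({v, c, a, b, d} : Set V) = {v, a, d, c, b} := by
        ext x
        simp only [Set.mem_insert_iff, Set.mem_singleton_iff]
        tauto
      rw [this]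
      exact isInducedC5On_of_adj (hRad _ _ hva) (hRad _ _ had) (hRad _ _ hcd.symm)
        (hRad _ _ hbc.symm) (hRad _ _ hvb.symm) (hRn _ _ hvd) (hRn _ _ hac) (hRn _ _ hbd.symm)
        (hRn _ _ hvc.symm) (hRn _ _ hab.symm)
  by_cases hac : Rᶜ.Adj a c
  · exact key c d hvc hvd hcd hac
  · refine key d c hvd hvc hcd.symm ?_
    by_contra had
    have hbc : Rᶜ.Adj b c := by
      have := hR hab hvc
      grind [SimpleGraph.adj_comm]
    have hbd : Rᶜ.Adj b d := by
      have := hR hab hvd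
      grind [SimpleGraph.adj_comm]
    have := hB hvb hcd
    grind

end SimpleGraph

open SimpleGraph in
theorem stmt_5 {V : Type*} [Fintype V] (B R : SimpleGraph V)
    (hB4 : IsC4Free B) (hR4 : IsC4Free R)
    (hcomplete : B ⊔ R = ⊤)
    (hnoDouble : ¬ HasDoubleC5 B R) :
    Obedient B R Set.univ := by
  have hB := twoEdgesMeet_compl_of_isC4Free hB4
  have hR := twoEdgesMeet_compl_of_isC4Free hR4
  have hdis : Disjoint Rᶜ Bᶜ := by
    rw [disjoint_iff, ← compl_sup, sup_comm, hcomplete, compl_top]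
  have hpair : ∀ v, ∃ A C : Set V, (v ∈ A ∨ v ∈ C) ∧ IsClosedPair Rᶜ Bᶜ A C := by
    intro v
    by_cases h₁ : ∀ a b, Bᶜ.Adj v a → Bᶜ.Adj v b → ¬ Rᶜ.Adj a b
    · obtain ⟨A, C, hv, h⟩ := exists_isClosedPair_left hR hB hdis h₁
      exact ⟨A, C, .inl hv, h⟩
    by_cases h₂ : ∀ a b, Rᶜ.Adj v a → Rᶜ.Adj v b → ¬ Bᶜ.Adj a b
    · obtain ⟨A, C, hv, h⟩ := exists_isClosedPair_left hB hR hdis.symm h₂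
      exact ⟨C, A, .inr hv, h.symm⟩
    push Not at h₁ h₂
    obtain ⟨a, b, hva, hvb, hab⟩ := h₁
    obtain ⟨c, d, hvc, hvd, hcd⟩ := h₂
    exact absurd (hasDoubleC5_of_triangles hB hR hdis hva hvb hab hvc hvd hcd) hnoDouble
  obtain ⟨X, Y, hX, hY, hXY⟩ := exists_partition_of_isClosedPair hpair Finset.univ
  refine ⟨X, Y, fun a ha b hb hne => ?_, fun a ha b hb hne => ?_, by simpa using hXY⟩
  · by_contra h
    exact hX a ha b hb ((compl_adj _ _ _).2 ⟨hne, h⟩)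
  · by_contra h
    exact hY a ha b hb ((compl_adj _ _ _).2 ⟨hne, h⟩)
end

section
/- Let B and R be C4-free simple graphs on the same finite vertex set V with G(B,R) the complete graph on V, and let v1, v2, v3, v4, v5 be a double C5 with blue edges and red diagonals. Then for every vertex x ∈ V \ {v1,...,v5}, one of the following holds: (1) x is B-adjacent to all of v1,...,v5; (2) x is R-adjacent to all of v1,...,v5; (3) there exists an index i (taken mod 5) such that xv_i is an edge of both B and R, x is adjacent in B but not in R to v_{i-1} and v_{i+1} (the neighbors of v_i on the blue cycle), and x is adjacent in R but not in B to v_{i-2} and v_{i+2} (the neighbors of v_i on the red cycle); in case (3) the edge xv_i is called the shared edge of x. -/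
/-- In a `C4`-free graph, a vertex adjacent to both ends of an induced path on three vertices is
adjacent to its middle vertex. -/
theorem IsC4Free.adj_of_adj_of_adj {V : Type*} {G : SimpleGraph V} (hG : IsC4Free G)
    {x a b c : V} (hxb : x ≠ b) (hac : a ≠ c) (hab : G.Adj a b) (hbc : G.Adj b c)
    (hnac : ¬ G.Adj a c) (hxa : G.Adj x a) (hxc : G.Adj x c) : G.Adj x b := by
  by_contra h
  exact hG ⟨x, a, b, c, hxb, hac, hxa, hab, hbc, hxc.symm, h, hnac⟩

/-- Let two predicates cover the 5-cycle. If the first is closed under taking the middle of three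
consecutive points, and the second under the analogous operation on the complementary 5-cycle, then
one of them holds everywhere, or they split the cycle into a path of three consecutive points and
the complementary path through the same center. -/
theorem forall_or_forall_or_exists_of_cyclic_closure {b r : Fin 5 → Prop}
    (hcover : ∀ i, b i ∨ r i) (hb : ∀ i, b i → b (i + 2) → b (i + 1))
    (hr : ∀ i, r i → r (i + 1) → r (i + 3)) :
    (∀ i, b i) ∨ (∀ i, r i) ∨
      ∃ i, b i ∧ r i ∧ (b (i + 1) ∧ ¬ r (i + 1)) ∧ (b (i - 1) ∧ ¬ r (i - 1)) ∧
        (r (i + 2) ∧ ¬ b (i + 2)) ∧ (r (i - 2) ∧ ¬ b (i - 2)) := by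
  have hneg₁ : (-1 : Fin 5) = 4 := rfl
  have hneg₂ : (-2 : Fin 5) = 3 := rfl
  simp [Fin.forall_fin_succ, Fin.exists_fin_succ, hneg₁, hneg₂] at hcover hb hr ⊢
  grind (splits := 40)

theorem stmt_6 {V : Type*} [Fintype V] (B R : SimpleGraph V)
    (hB4 : IsC4Free B) (hR4 : IsC4Free R)
    (hcomplete : B ⊔ R = ⊤)
    -- a double C5 with blue edges and red diagonals
    (v : Fin 5 → V) (hv : Function.Injective v)
    (hblue : ∀ i, B.Adj (v i) (v (i + 1)) ∧ ¬ R.Adj (v i) (v (i + 1)))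
    (hred : ∀ i, R.Adj (v i) (v (i + 2)) ∧ ¬ B.Adj (v i) (v (i + 2)))
    (x : V) (hx : x ∉ Set.range v) :
    (∀ i, B.Adj x (v i)) ∨ (∀ i, R.Adj x (v i)) ∨
      (∃ i, B.Adj x (v i) ∧ R.Adj x (v i) ∧
        (B.Adj x (v (i + 1)) ∧ ¬ R.Adj x (v (i + 1))) ∧
        (B.Adj x (v (i - 1)) ∧ ¬ R.Adj x (v (i - 1))) ∧
        (R.Adj x (v (i + 2)) ∧ ¬ B.Adj x (v (i + 2))) ∧
        (R.Adj x (v (i - 2)) ∧ ¬ B.Adj x (v (i - 2)))) := by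
  have hne : ∀ i, x ≠ v i := fun i h => hx ⟨i, h.symm⟩
  have hcover : ∀ i, B.Adj x (v i) ∨ R.Adj x (v i) := fun i => by
    rw [← SimpleGraph.sup_adj, hcomplete]
    exact hne i
  have hBmid : ∀ i, B.Adj x (v i) → B.Adj x (v (i + 2)) → B.Adj x (v (i + 1)) := fun i => by
    have hstep := (hblue (i + 1)).1
    rw [show i + 1 + 1 = i + 2 from add_assoc i 1 1] at hstep
    exact hB4.adj_of_adj_of_adj (hne _) (hred i).1.ne (hblue i).1 hstep (hred i).2
  have hRmid : ∀ i, R.Adj x (v i) → R.Adj x (v (i + 1)) → R.Adj x (v (i + 3)) := fun i => by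
    have hstep₁ := (hred (i + 1)).1
    have hstep₂ := (hred (i + 3)).1
    rw [show i + 1 + 2 = i + 3 from add_assoc i 1 2] at hstep₁
    rw [show i + 3 + 2 = i by fin_cases i <;> rfl] at hstep₂
    exact hR4.adj_of_adj_of_adj (hne _) (hblue i).1.ne hstep₂.symm hstep₁.symm (hblue i).2
  exact forall_or_forall_or_exists_of_cyclic_closure hcover hBmid hRmid
end

section
/- Let B and R be C4-free simple graphs on the same finite vertex set V and assume that G(B,R) is the complete graph on V. Then there exist a clique X of B, a clique Y of R, and a set Z that is a clique in both B and R, such that V = X ∪ Y ∪ Z. Moreover, every x ∈ Z is a vertex of some double C5 of G(B,R), i.e., there is a five-element set S ⊆ V with x ∈ S such that the induced subgraphs B|S and R|S are both cycles of length five. -/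
/-- A graph has no induced matching of two edges. -/
def IsTwoK2Free {V : Type*} (G : SimpleGraph V) : Prop :=
  ∀ a b c d : V, G.Adj a b → G.Adj c d →
    a = c ∨ a = d ∨ b = c ∨ b = d ∨ G.Adj a c ∨ G.Adj a d ∨ G.Adj b c ∨ G.Adj b d

theorem IsC4Free.isTwoK2Free_compl {V : Type*} {G : SimpleGraph V} (h : IsC4Free G) :
    IsTwoK2Free Gᶜ := by
  intro a b c d hab hcd
  by_contra! hn
  simp only [SimpleGraph.compl_adj] at hab hcd hn
  refine h ⟨a, c, b, d, hab.1, hcd.1, ?_, ?_, ?_, ?_, hab.2, hcd.2⟩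
  · tauto
  · exact SimpleGraph.Adj.symm (by tauto)
  · tauto
  · exact SimpleGraph.Adj.symm (by tauto)

/-- Five vertices forming a five-cycle of `P` whose chords form a five-cycle of `Q`. -/
def IsPentagon {V : Type*} (P Q : SimpleGraph V) (a b c d e : V) : Prop :=
  (P.Adj a b ∧ P.Adj b c ∧ P.Adj c d ∧ P.Adj d e ∧ P.Adj e a) ∧
    (Q.Adj a c ∧ Q.Adj b d ∧ Q.Adj c e ∧ Q.Adj d a ∧ Q.Adj e b)

section Pentagon

variable {V : Type*} {P Q : SimpleGraph V} {a b c d e : V}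

theorem IsPentagon.rotate (h : IsPentagon P Q a b c d e) : IsPentagon P Q b c d e a := by
  unfold IsPentagon at *; tauto

theorem IsPentagon.swap (h : IsPentagon P Q a b c d e) : IsPentagon Q P a c e b d := by
  have hPs : ∀ x y, P.Adj x y → P.Adj y x := fun _ _ h => h.symm
  unfold IsPentagon at *; grind

/-- `P`-neighbours on a pentagon come in `Q`-adjacent pairs. -/
theorem IsPentagon.adj_or_adj (hP : IsTwoK2Free P) (hPQ : ∀ x y, P.Adj x y → ¬ Q.Adj x y)
    (h : IsPentagon P Q a b c d e) {u : V} (hu : P.Adj u a) : P.Adj u c ∨ P.Adj u d := by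
  have hPs : ∀ x y, P.Adj x y → P.Adj y x := fun _ _ h => h.symm
  have hQs : ∀ x y, Q.Adj x y → Q.Adj y x := fun _ _ h => h.symm
  have := hP u a c d hu
  have := P.ne_of_adj (a := a) (b := b)
  have := Q.ne_of_adj (a := a) (b := c)
  have := Q.ne_of_adj (a := d) (b := a)
  unfold IsPentagon at h
  grind

/-- Two vertices completing the same path to a pentagon are `P`-nonadjacent. -/
theorem IsPentagon.not_adj_of_twins (hP : IsTwoK2Free P) (hPQ : ∀ x y, P.Adj x y → ¬ Q.Adj x y)
    {a' : V} (h : IsPentagon P Q a b c d e) (h' : IsPentagon P Q a' b c d e) :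
    ¬ P.Adj a a' := by
  intro hu
  have hPs : ∀ x y, P.Adj x y → P.Adj y x := fun _ _ h => h.symm
  have hQs : ∀ x y, Q.Adj x y → Q.Adj y x := fun _ _ h => h.symm
  have := hP a a' c d hu
  have := fun x y => Q.ne_of_adj (a := x) (b := y)
  unfold IsPentagon at h h'
  grind

/-- Replacing two `Q`-adjacent vertices of a pentagon keeps them `Q`-adjacent. -/
theorem IsPentagon.adj_of_replace (hQ : IsTwoK2Free Q) (hPQ : ∀ x y, P.Adj x y → ¬ Q.Adj x y)
    {b' e' : V} (h : IsPentagon P Q a b' c d e) (h' : IsPentagon P Q a b c d e') :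
    Q.Adj b' e' := by
  have hPs : ∀ x y, P.Adj x y → P.Adj y x := fun _ _ h => h.symm
  have hQs : ∀ x y, Q.Adj x y → Q.Adj y x := fun _ _ h => h.symm
  have := hQ b' d e' c
  have := fun x y => P.ne_of_adj (a := x) (b := y)
  have := fun x => Q.irrefl (v := x)
  unfold IsPentagon at h h'
  by_cases hbe : b' = e'
  · grind
  · grind

/-- A vertex whose `P`-neighbours on a pentagon avoid the side opposite to `a` is not
`P`-adjacent to `a`. -/
theorem IsPentagon.not_adj_twin (hP : IsTwoK2Free P) (hPQ : ∀ x y, P.Adj x y → ¬ Q.Adj x y)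
    {u : V} (h : IsPentagon P Q a b c d e) (hc : ¬ P.Adj u c) (hd : ¬ P.Adj u d) :
    ¬ P.Adj u a := fun hu => by
  have := h.adj_or_adj hP hPQ hu
  tauto

/-- Two vertices with no `P`-neighbour on a pentagon are `P`-nonadjacent. -/
theorem IsPentagon.not_adj_of_not_adj (hP : IsTwoK2Free P)
    {u v : V} (h : IsPentagon P Q a b c d e)
    (hua : ¬ P.Adj u a) (hub : ¬ P.Adj u b)
    (hva : ¬ P.Adj v a) (hvb : ¬ P.Adj v b) : ¬ P.Adj u v := fun huv => by
  have hPs : ∀ x y, P.Adj x y → P.Adj y x := fun _ _ h => h.symm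
  have := hP u v a b huv h.1.1
  have := h.1.1
  grind

/-- A vertex with both a `P`- and a `Q`-neighbour on a pentagon is a twin of one of its
vertices. -/
theorem IsPentagon.exists_twin (hP : IsTwoK2Free P) (hQ : IsTwoK2Free Q)
    (hPQ : ∀ x y, P.Adj x y → ¬ Q.Adj x y) {u : V} (h : IsPentagon P Q a b c d e)
    (hu : P.Adj u a ∨ P.Adj u b ∨ P.Adj u c ∨ P.Adj u d ∨ P.Adj u e)
    (hu' : Q.Adj u a ∨ Q.Adj u b ∨ Q.Adj u c ∨ Q.Adj u d ∨ Q.Adj u e) :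
    IsPentagon P Q u b c d e ∨ IsPentagon P Q a u c d e ∨ IsPentagon P Q a b u d e ∨
      IsPentagon P Q a b c u e ∨ IsPentagon P Q a b c d u := by
  have hQP : ∀ x y, Q.Adj x y → ¬ P.Adj x y := fun x y h h' => hPQ x y h' h
  have r1 := h.rotate
  have r2 := r1.rotate
  have r3 := r2.rotate
  have r4 := r3.rotate
  have p0 := fun hu => h.adj_or_adj hP hPQ (u := u) hu
  have p1 := fun hu => r1.adj_or_adj hP hPQ (u := u) hu
  have p2 := fun hu => r2.adj_or_adj hP hPQ (u := u) hu
  have p3 := fun hu => r3.adj_or_adj hP hPQ (u := u) hu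
  have p4 := fun hu => r4.adj_or_adj hP hPQ (u := u) hu
  have q0 := fun hu => h.swap.adj_or_adj hQ hQP (u := u) hu
  have q1 := fun hu => r1.swap.adj_or_adj hQ hQP (u := u) hu
  have q2 := fun hu => r2.swap.adj_or_adj hQ hQP (u := u) hu
  have q3 := fun hu => r3.swap.adj_or_adj hQ hQP (u := u) hu
  have q4 := fun hu => r4.swap.adj_or_adj hQ hQP (u := u) hu
  have da := hPQ u a
  have db := hPQ u b
  have dc := hPQ u c
  have dd := hPQ u d
  have de := hPQ u e
  clear r1 r2 r3 r4 hQP hPQ hP hQ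
  unfold IsPentagon at *
  simp only [P.adj_comm _ u, Q.adj_comm _ u]
  grind (splits := 40)

end Pentagon

section TwoGraphs

variable {V : Type*} {P Q : SimpleGraph V}

/-- If a pentagon exists, it organises a partition of the vertex set. -/
theorem exists_cover_of_isPentagon (hP : IsTwoK2Free P) (hQ : IsTwoK2Free Q)
    (hPQ : ∀ x y, P.Adj x y → ¬ Q.Adj x y) {a b c d e : V} (h : IsPentagon P Q a b c d e) :
    ∃ X Y Z : Set V, (∀ x ∈ X, ∀ y ∈ X, ¬ P.Adj x y) ∧ (∀ x ∈ Y, ∀ y ∈ Y, ¬ Q.Adj x y) ∧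
      (∀ x ∈ Z, ∀ y ∈ Z, ¬ P.Adj x y ∧ ¬ Q.Adj x y) ∧ (∀ x, x ∈ X ∨ x ∈ Y ∨ x ∈ Z) ∧
      ∀ x ∈ Z, IsPentagon P Q x b c d e := by
  have hQP : ∀ x y, Q.Adj x y → ¬ P.Adj x y := fun x y h h' => hPQ x y h' h
  have rot : ∀ {a b c d e}, IsPentagon P Q a b c d e → IsPentagon P Q b c d e a :=
    fun h => h.rotate
  refine ⟨{x | IsPentagon P Q a x c d e ∨ IsPentagon P Q a b c d x ∨
        ¬ (P.Adj x a ∨ P.Adj x b ∨ P.Adj x c ∨ P.Adj x d ∨ P.Adj x e)},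
      {x | IsPentagon P Q a b x d e ∨ IsPentagon P Q a b c x e ∨
        ¬ (Q.Adj x a ∨ Q.Adj x b ∨ Q.Adj x c ∨ Q.Adj x d ∨ Q.Adj x e)},
      {x | IsPentagon P Q x b c d e}, ?_, ?_, ?_, ?_, fun x hx => hx⟩
  · rintro x (hx | hx | hx) y (hy | hy | hy)
    · exact (rot hx).not_adj_of_twins hP hPQ (rot hy)
    · exact hQP _ _ (hx.adj_of_replace hQ hPQ hy)
    · rw [P.adj_comm]
      exact (rot hx).not_adj_twin hP hPQ (by tauto) (by tauto)
    · rw [P.adj_comm]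
      exact hQP _ _ (hy.adj_of_replace hQ hPQ hx)
    · exact (rot (rot (rot (rot hx)))).not_adj_of_twins hP hPQ (rot (rot (rot (rot hy))))
    · rw [P.adj_comm]
      exact (rot (rot (rot (rot hx)))).not_adj_twin hP hPQ (by tauto) (by tauto)
    · exact (rot hy).not_adj_twin hP hPQ (by tauto) (by tauto)
    · exact (rot (rot (rot (rot hy)))).not_adj_twin hP hPQ (by tauto) (by tauto)
    · exact h.not_adj_of_not_adj hP (by tauto) (by tauto) (by tauto) (by tauto)
  · rintro x (hx | hx | hx) y (hy | hy | hy)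
    · exact (rot (rot hx)).swap.not_adj_of_twins hQ hQP (rot (rot hy)).swap
    · exact hPQ _ _ (hx.swap.adj_of_replace hP hQP hy.swap)
    · rw [Q.adj_comm]
      exact (rot (rot hx)).swap.not_adj_twin hQ hQP (by tauto) (by tauto)
    · rw [Q.adj_comm]
      exact hPQ _ _ (hy.swap.adj_of_replace hP hQP hx.swap)
    · exact (rot (rot (rot hx))).swap.not_adj_of_twins hQ hQP (rot (rot (rot hy))).swap
    · rw [Q.adj_comm]
      exact (rot (rot (rot hx))).swap.not_adj_twin hQ hQP (by tauto) (by tauto)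
    · exact (rot (rot hy)).swap.not_adj_twin hQ hQP (by tauto) (by tauto)
    · exact (rot (rot (rot hy))).swap.not_adj_twin hQ hQP (by tauto) (by tauto)
    · exact h.swap.not_adj_of_not_adj hQ (by tauto) (by tauto) (by tauto) (by tauto)
  · exact fun x hx y hy =>
      ⟨IsPentagon.not_adj_of_twins hP hPQ hx hy,
        IsPentagon.not_adj_of_twins hQ hQP (IsPentagon.swap hx) (IsPentagon.swap hy)⟩
  · intro x
    simp only [Set.mem_ofPred_eq]
    have := h.exists_twin hP hQ hPQ (u := x)
    tauto

/-- The vertex `v` is the apex of a triangle with two sides in `P` and base in `Q`. -/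
def IsApex (P Q : SimpleGraph V) (v : V) : Prop :=
  ∃ x y, P.Adj v x ∧ P.Adj v y ∧ Q.Adj x y

theorem exists_isPentagon_of_isApex (hP : IsTwoK2Free P) (hQ : IsTwoK2Free Q)
    (hPQ : ∀ x y, P.Adj x y → ¬ Q.Adj x y) {v : V}
    (h : IsApex P Q v) (h' : IsApex Q P v) : ∃ a b c d e, IsPentagon P Q a b c d e := by
  obtain ⟨x, y, hvx, hvy, hxy⟩ := h
  obtain ⟨z, w, hvz, hvw, hzw⟩ := h'
  have hPs : ∀ x y, P.Adj x y → P.Adj y x := fun _ _ h => h.symm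
  have hQs : ∀ x y, Q.Adj x y → Q.Adj y x := fun _ _ h => h.symm
  have h1 := hP v x z w hvx hzw
  have h2 := hP v y z w hvy hzw
  have h3 := hQ v z x y hvz hxy
  have h4 := hQ v w x y hvw hxy
  by_cases hxz : P.Adj x z
  · refine ⟨v, x, z, w, y, ?_⟩
    unfold IsPentagon
    grind (splits := 40)
  · refine ⟨v, x, w, z, y, ?_⟩
    unfold IsPentagon
    grind (splits := 40)

theorem IsApex.not_adj (hQ : IsTwoK2Free Q) (hPQ : ∀ x y, P.Adj x y → ¬ Q.Adj x y)
    (hap : ∀ v, IsApex P Q v → ¬ IsApex Q P v) {p q : V}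
    (hp : IsApex P Q p) (hq : IsApex P Q q) : ¬ Q.Adj p q := by
  intro hpq
  obtain ⟨x, y, hqx, hqy, hxy⟩ := hq
  have hPs : ∀ x y, P.Adj x y → P.Adj y x := fun _ _ h => h.symm
  have hQs : ∀ x y, Q.Adj x y → Q.Adj y x := fun _ _ h => h.symm
  have hx : ¬ Q.Adj p x := fun h => hap p hp ⟨x, q, h, hpq, hqx.symm⟩
  have hy : ¬ Q.Adj p y := fun h => hap p hp ⟨y, q, h, hpq, hqy.symm⟩
  have := hQ p q x y hpq hxy
  grind

theorem IsApex.not_isApex_of_path (hP : IsTwoK2Free P) (hQ : IsTwoK2Free Q)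
    (hPQ : ∀ x y, P.Adj x y → ¬ Q.Adj x y) (hap : ∀ v, IsApex P Q v → ¬ IsApex Q P v)
    {v z w : V} (h : IsApex P Q v) (hvz : Q.Adj v z) (hzw : P.Adj z w) :
    ¬ IsApex Q P w := by
  intro h'
  have hw : ¬ IsApex P Q w := fun hw => hap w hw h'
  have hvwQ : ¬ Q.Adj v w := fun hvw => hap v h ⟨z, w, hvz, hvw, hzw⟩
  obtain ⟨x, y, hvx, hvy, hxy⟩ := h
  have hPs : ∀ x y, P.Adj x y → P.Adj y x := fun _ _ h => h.symm
  have hQs : ∀ x y, Q.Adj x y → Q.Adj y x := fun _ _ h => h.symm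
  have hvw : ¬ P.Adj v w := fun hvw => hw ⟨v, z, hvw.symm, hzw.symm, hvz⟩
  have hxyw : ¬ (P.Adj x w ∧ P.Adj y w) := fun hh => hw ⟨x, y, hh.1.symm, hh.2.symm, hxy⟩
  have key : ∀ x y, P.Adj v x → P.Adj v y → Q.Adj x y → ¬ P.Adj x z := by
    intro x y hvx hvy hxy hxz
    have hyz : Q.Adj y z := by
      have := hQ x y z v hxy hvz.symm
      grind
    have hyw : P.Adj y w := by
      have := hP v y z w hvy hzw
      grind
    exact hw ⟨y, z, hyw.symm, hzw.symm, hyz⟩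
  have k1 := key x y hvx hvy hxy
  have k2 := key y x hvy hvx hxy.symm
  have h1 := hP v x z w hvx hzw
  have h2 := hP v y z w hvy hzw
  grind

/-- In a partition into a `P`-independent and a `Q`-independent set, apexes with sides in `P` are
in the latter, apexes with sides in `Q` in the former; `v` is forced to be in the latter set. -/
def IsForced (P Q : SimpleGraph V) (v : V) : Prop :=
  IsApex P Q v ∨ (∃ a, P.Adj v a ∧ IsApex Q P a) ∨ ∃ a c, P.Adj v a ∧ Q.Adj a c ∧ IsApex P Q c

/-- Either the path `v`, `z`, `w`, `q` with edges in `Q`, `P`, `Q` has a shortcut in `Q`, or one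
of its ends is an apex. -/
theorem adj_or_isApex_of_path (hQ : IsTwoK2Free Q) (hPQ : ∀ x y, P.Adj x y → ¬ Q.Adj x y)
    {v z w q : V} (hvz : Q.Adj v z) (hzw : P.Adj z w) (hwq : Q.Adj w q) :
    Q.Adj v q ∨ IsApex Q P v ∨ IsApex Q P q := by
  rcases hQ v z w q hvz hwq with rfl | rfl | rfl | rfl | h | h | h | h
  · exact absurd hvz.symm (hPQ _ _ hzw)
  · exact .inr (.inl ⟨z, w, hvz, hwq.symm, hzw⟩)
  · exact absurd hzw P.irrefl
  · exact absurd hwq.symm (hPQ _ _ hzw)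
  · exact .inr (.inl ⟨z, w, hvz, h, hzw⟩)
  · exact .inl h
  · exact absurd h (hPQ _ _ hzw)
  · exact .inr (.inr ⟨z, w, h.symm, hwq.symm, hzw⟩)

theorem IsForced.of_adj (hQ : IsTwoK2Free Q) (hPQ : ∀ x y, P.Adj x y → ¬ Q.Adj x y)
    (hap : ∀ v, IsApex P Q v → ¬ IsApex Q P v) {v w : V}
    (h : IsForced P Q v) (hvw : Q.Adj v w) : IsForced Q P w := by
  rcases h with h | ⟨a, hva, ha⟩ | ⟨a, c, hva, hac, hc⟩
  · exact .inr (.inl ⟨v, hvw.symm, h⟩)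
  · exact .inr (.inr ⟨v, a, hvw.symm, hva, ha⟩)
  · rcases adj_or_isApex_of_path hQ hPQ hac.symm hva.symm hvw with h | h | h
    · exact .inr (.inl ⟨c, h.symm, hc⟩)
    · exact absurd h (hap c hc)
    · exact .inl h

theorem IsForced.not_isForced (hP : IsTwoK2Free P) (hQ : IsTwoK2Free Q)
    (hPQ : ∀ x y, P.Adj x y → ¬ Q.Adj x y) (hap : ∀ v, IsApex P Q v → ¬ IsApex Q P v)
    {v : V} (h : IsForced P Q v) : ¬ IsForced Q P v := by
  have hQP : ∀ x y, Q.Adj x y → ¬ P.Adj x y := fun x y h h' => hPQ x y h' h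
  have hap' : ∀ v, IsApex Q P v → ¬ IsApex P Q v := fun v h h' => hap v h' h
  rintro (h' | ⟨b, hvb, hb⟩ | ⟨b, d, hvb, hbd, hd⟩)
  · rcases h with h | ⟨a, hva, ha⟩ | ⟨a, c, hva, hac, hc⟩
    · exact hap v h h'
    · exact h'.not_adj hP hQP hap' ha hva
    · exact hc.not_isApex_of_path hP hQ hPQ hap hac.symm hva.symm h'
  · rcases h with h | ⟨a, hva, ha⟩ | ⟨a, c, hva, hac, hc⟩
    · exact h.not_adj hQ hPQ hap hb hvb
    · exact hb.not_isApex_of_path hP hQ hPQ hap hvb.symm hva ha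
    · rcases adj_or_isApex_of_path hQ hPQ hac.symm hva.symm hvb with h | h | h
      · exact hc.not_adj hQ hPQ hap hb h
      · exact hap c hc h
      · exact hap b hb h
  · rcases h with h | ⟨a, hva, ha⟩ | ⟨a, c, hva, hac, hc⟩
    · exact h.not_isApex_of_path hP hQ hPQ hap hvb hbd hd
    · rcases adj_or_isApex_of_path hP hQP hbd.symm hvb.symm hva with h | h | h
      · exact hd.not_adj hP hQP hap' ha h
      · exact hap d h hd
      · exact hap a h ha
    · rcases adj_or_isApex_of_path hP hQP hbd.symm hvb.symm hva with h | h | h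
      · exact hc.not_isApex_of_path hP hQ hPQ hap hac.symm h.symm hd
      · exact hap d h hd
      · exact h.not_adj hQ hPQ hap hc hac

/-- A set of vertices that are not apexes splits into a `P`-independent and a `Q`-independent
set. -/
theorem exists_split_of_forall_not_isApex [Finite V] (hP : IsTwoK2Free P)
    (hPQ : ∀ x y, P.Adj x y → ¬ Q.Adj x y) (W : Set V) (hW : ∀ v ∈ W, ¬ IsApex P Q v) :
    ∃ X ⊆ W, ∃ Y ⊆ W, W ⊆ X ∪ Y ∧
      (∀ x ∈ X, ∀ y ∈ X, ¬ P.Adj x y) ∧ ∀ x ∈ Y, ∀ y ∈ Y, ¬ Q.Adj x y := by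
  induction W using WellFoundedLT.induction with
  | ind W ih =>
  rcases W.eq_empty_or_nonempty with rfl | ⟨v, hv⟩
  · exact ⟨∅, by simp, ∅, by simp⟩
  have hQP : ∀ x y, Q.Adj x y → ¬ P.Adj x y := fun x y h h' => hPQ x y h' h
  set A : Set V := {a | a ∈ W ∧ P.Adj v a}
  set C : Set V := {c | c ∈ W ∧ (c = v ∨ ∃ a ∈ A, Q.Adj a c)}
  have hAA : ∀ x ∈ A, ∀ y ∈ A, ¬ Q.Adj x y := fun x hx y hy hxy =>
    hW v hv ⟨x, y, hx.2, hy.2, hxy⟩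
  have hCA : ∀ x ∈ C, x ∉ A := by
    rintro x ⟨hx, rfl | ⟨a, ha, hax⟩⟩ hxA
    · exact P.irrefl hxA.2
    · exact hAA a ha x hxA hax
  have hCnbr : ∀ x ∈ C, ∀ u ∈ W, P.Adj x u → u ∈ A := by
    rintro x ⟨hx, rfl | ⟨a, ha, hax⟩⟩ u hu hxu
    · exact ⟨hu, hxu⟩
    · rcases adj_or_isApex_of_path hP hQP ha.2 hax hxu with h | h | h
      · exact ⟨hu, h⟩
      · exact absurd h (hW v hv)
      · exact absurd h (hW u hu)
  have hss : W \ (A ∪ C) ⊂ W :=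
    ⟨Set.sdiff_subset, fun h => (h hv).2 (Or.inr ⟨hv, Or.inl rfl⟩)⟩
  obtain ⟨X, hX, Y, hY, hcov, hXi, hYi⟩ := ih _ hss fun v hv => hW v hv.1
  refine ⟨X ∪ C, ?_, Y ∪ A, ?_, ?_, ?_, ?_⟩
  · exact Set.union_subset (hX.trans Set.sdiff_subset) fun x hx => hx.1
  · exact Set.union_subset (hY.trans Set.sdiff_subset) fun x hx => hx.1
  · intro x hx
    have := @hcov x
    simp only [Set.mem_sdiff, Set.mem_union] at this ⊢
    tauto
  · rintro x (hx | hx) y (hy | hy) hxy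
    · exact hXi x hx y hy hxy
    · exact (hX hx).2 (Or.inl (hCnbr y hy x (hX hx).1 hxy.symm))
    · exact (hX hy).2 (Or.inl (hCnbr x hx y (hX hy).1 hxy))
    · exact hCA y hy (hCnbr x hx y hy.1 hxy)
  · rintro x (hx | hx) y (hy | hy) hxy
    · exact hYi x hx y hy hxy
    · exact (hY hx).2 (Or.inr ⟨(hY hx).1, Or.inr ⟨y, hy, hxy.symm⟩⟩)
    · exact (hY hy).2 (Or.inr ⟨(hY hy).1, Or.inr ⟨x, hx, hxy⟩⟩)
    · exact hAA x hx y hy hxy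

theorem exists_split_of_forall_not_isPentagon [Finite V] (hP : IsTwoK2Free P)
    (hQ : IsTwoK2Free Q) (hPQ : ∀ x y, P.Adj x y → ¬ Q.Adj x y)
    (hno : ¬ ∃ a b c d e, IsPentagon P Q a b c d e) :
    ∃ X Y : Set V, (∀ x, x ∈ X ∨ x ∈ Y) ∧
      (∀ x ∈ X, ∀ y ∈ X, ¬ P.Adj x y) ∧ ∀ x ∈ Y, ∀ y ∈ Y, ¬ Q.Adj x y := by
  have hQP : ∀ x y, Q.Adj x y → ¬ P.Adj x y := fun x y h h' => hPQ x y h' h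
  have hap : ∀ v, IsApex P Q v → ¬ IsApex Q P v := fun v h h' =>
    hno (exists_isPentagon_of_isApex hP hQ hPQ h h')
  have hap' : ∀ v, IsApex Q P v → ¬ IsApex P Q v := fun v h h' => hap v h' h
  obtain ⟨X, hX, Y, hY, hcov, hXi, hYi⟩ := exists_split_of_forall_not_isApex hP hPQ
    {v | ¬ IsForced P Q v ∧ ¬ IsForced Q P v} fun v hv h => hv.1 (.inl h)
  refine ⟨X ∪ {v | IsForced Q P v}, Y ∪ {v | IsForced P Q v}, ?_, ?_, ?_⟩
  · intro x
    have := @hcov x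
    simp only [Set.mem_ofPred_eq, Set.mem_union] at this ⊢
    grind
  · rintro x (hx | hx) y (hy | hy) hxy
    · exact hXi x hx y hy hxy
    · exact (hX hx).1 (IsForced.of_adj hP hQP hap' hy hxy.symm)
    · exact (hX hy).1 (IsForced.of_adj hP hQP hap' hx hxy)
    · exact (IsForced.of_adj hP hQP hap' hx hxy).not_isForced hP hQ hPQ hap hy
  · rintro x (hx | hx) y (hy | hy) hxy
    · exact hYi x hx y hy hxy
    · exact (hY hx).2 (IsForced.of_adj hQ hPQ hap hy hxy.symm)
    · exact (hY hy).2 (IsForced.of_adj hQ hPQ hap hx hxy)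
    · exact IsForced.not_isForced hP hQ hPQ hap hy (IsForced.of_adj hQ hPQ hap hx hxy)

end TwoGraphs

theorem IsPentagon.isInducedC5On {V : Type*} {P G : SimpleGraph V} {a b c d e : V}
    (h : IsPentagon P Gᶜ a b c d e) (hPG : P ≤ G) :
    IsInducedC5On G {a, b, c, d, e} := by
  obtain ⟨⟨p1, p2, p3, p4, p5⟩, q1, q2, q3, q4, q5⟩ := h
  refine ⟨![a, b, c, d, e], ?_, ?_, ?_, ?_⟩
  · have := p1.ne; have := p2.ne; have := p3.ne; have := p4.ne; have := p5.ne
    have := q1.ne; have := q2.ne; have := q3.ne; have := q4.ne; have := q5.ne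
    intro i j
    fin_cases i <;> fin_cases j <;> simp <;> grind
  · ext x
    simp [eq_comm]
    tauto
  · intro i
    fin_cases i
    exacts [hPG p1, hPG p2, hPG p3, hPG p4, hPG p5]
  · intro i
    fin_cases i
    exacts [q1.2, q2.2, q3.2, q4.2, q5.2]

theorem stmt_8 {V : Type*} [Fintype V] (B R : SimpleGraph V)
    (hB4 : IsC4Free B) (hR4 : IsC4Free R)
    (hcomplete : B ⊔ R = ⊤) :
    ∃ X Y Z : Set V, B.IsClique X ∧ R.IsClique Y ∧
      B.IsClique Z ∧ R.IsClique Z ∧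
      Set.univ = X ∪ Y ∪ Z ∧
      ∀ x ∈ Z, ∃ S : Set V, x ∈ S ∧ IsInducedC5On B S ∧ IsInducedC5On R S := by
  have hBR : ∀ x y, x ≠ y → B.Adj x y ∨ R.Adj x y := fun x y hxy => by
    have : (B ⊔ R).Adj x y := hcomplete ▸ hxy
    exact this
  have hP := hB4.isTwoK2Free_compl
  have hQ := hR4.isTwoK2Free_compl
  have hPQ : ∀ x y, Bᶜ.Adj x y → ¬ Rᶜ.Adj x y := fun x y h h' =>
    (hBR x y h.1).elim h.2 h'.2
  have hPR : Bᶜ ≤ R := fun x y h => (hBR x y h.1).resolve_left h.2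
  have hQB : Rᶜ ≤ B := fun x y h => (hBR x y h.1).resolve_right h.2
  have clique : ∀ (G : SimpleGraph V) (S : Set V), (∀ x ∈ S, ∀ y ∈ S, ¬ Gᶜ.Adj x y) →
      G.IsClique S := fun G S h x hx y hy hxy => by
    by_contra hn
    exact h x hx y hy ⟨hxy, hn⟩
  by_cases hex : ∃ a b c d e, IsPentagon Bᶜ Rᶜ a b c d e
  · obtain ⟨a, b, c, d, e, h⟩ := hex
    obtain ⟨X, Y, Z, hX, hY, hZ, hcov, hpent⟩ := exists_cover_of_isPentagon hP hQ hPQ h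
    refine ⟨X, Y, Z, clique B X hX, clique R Y hY,
      clique B Z fun x hx y hy => (hZ x hx y hy).1, clique R Z fun x hx y hy => (hZ x hx y hy).2,
      ?_, fun x hx => ⟨{x, b, c, d, e}, by simp, ?_, (hpent x hx).isInducedC5On hPR⟩⟩
    · ext x
      have := hcov x
      simp only [Set.mem_univ, Set.mem_union, true_iff]
      tauto
    · have hset : ({x, b, c, d, e} : Set V) = {x, c, e, b, d} := by
        ext y
        simp only [Set.mem_insert_iff, Set.mem_singleton_iff]
        tauto
      rw [hset]
      exact (hpent x hx).swap.isInducedC5On hQB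
  · obtain ⟨X, Y, hcov, hX, hY⟩ := exists_split_of_forall_not_isPentagon hP hQ hPQ hex
    refine ⟨X, Y, ∅, clique B X hX, clique R Y hY, by simp, by simp, ?_, by simp⟩
    ext x
    simpa using hcov x
end

section
/- Let B and R be C4-free simple graphs on the same finite vertex set V such that G(B,R) is the complete graph on V and G(B,R) does not contain a double C5. Suppose v1-v2-v3-v4-v5-v1 is an induced C5 in R (consecutive pairs R-adjacent, non-consecutive pairs R-non-adjacent) with v1v2 and v3v4 edges of R but not of B. Then v2v3 is an edge of R but not of B, both v1v5 and v4v5 are edges of B, {v1, v4, v5} is a clique of B, and {v2, v3} is a clique of R; in particular {v1, v2, v3, v4, v5} is obedient. -/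
theorem isInducedC5On_range {V : Type*} {G : SimpleGraph V} {a b c d e : V}
    (hinj : Function.Injective ![a, b, c, d, e])
    (hab : G.Adj a b) (hbc : G.Adj b c) (hcd : G.Adj c d) (hde : G.Adj d e) (hea : G.Adj e a)
    (hac : ¬ G.Adj a c) (hbd : ¬ G.Adj b d) (hce : ¬ G.Adj c e)
    (hda : ¬ G.Adj d a) (heb : ¬ G.Adj e b) :
    IsInducedC5On G (Set.range ![a, b, c, d, e]) :=
  ⟨_, hinj, rfl, by intro i; fin_cases i <;> assumption,
    by intro i; fin_cases i <;> assumption⟩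

theorem stmt_13 {V : Type*} [Fintype V] (B R : SimpleGraph V)
    (hB4 : IsC4Free B) (hR4 : IsC4Free R)
    (hcomplete : B ⊔ R = ⊤)
    (hnoDouble : ¬ HasDoubleC5 B R)
    (v₁ v₂ v₃ v₄ v₅ : V)
    (hdist : [v₁, v₂, v₃, v₄, v₅].Pairwise (· ≠ ·))
    -- induced C5 in R
    (h12 : R.Adj v₁ v₂) (h23 : R.Adj v₂ v₃) (h34 : R.Adj v₃ v₄)
    (h45 : R.Adj v₄ v₅) (h51 : R.Adj v₅ v₁)
    (h13 : ¬ R.Adj v₁ v₃) (h24 : ¬ R.Adj v₂ v₄) (h35 : ¬ R.Adj v₃ v₅)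
    (h41 : ¬ R.Adj v₄ v₁) (h52 : ¬ R.Adj v₅ v₂)
    -- v₁v₂ and v₃v₄ are edges of R but not of B
    (hb12 : ¬ B.Adj v₁ v₂) (hb34 : ¬ B.Adj v₃ v₄) :
    (R.Adj v₂ v₃ ∧ ¬ B.Adj v₂ v₃) ∧ B.Adj v₁ v₅ ∧ B.Adj v₄ v₅ ∧
      B.IsClique ({v₁, v₄, v₅} : Set V) ∧ R.IsClique ({v₂, v₃} : Set V) ∧
      Obedient B R ({v₁, v₂, v₃, v₄, v₅} : Set V) := by
  have key : ∀ {x y : V}, x ≠ y → ¬ R.Adj x y → B.Adj x y := by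
    intro x y hxy hR
    have h : (B ⊔ R).Adj x y := by rw [hcomplete]; exact hxy
    exact h.resolve_right hR
  simp only [List.pairwise_cons, List.mem_cons, List.not_mem_nil, or_false, forall_eq_or_imp,
    forall_eq, IsEmpty.forall_iff, implies_true, List.Pairwise.nil, and_true] at hdist
  obtain ⟨⟨n12, n13, n14, n15⟩, ⟨n23, n24, n25⟩, ⟨n34, n35⟩, n45⟩ := hdist
  have b13 := key n13 h13
  have b24 := key n24 h24
  have b35 := key n35 h35
  have b41 := key n14.symm h41
  have b52 := key n25.symm h52
  have b23 : ¬ B.Adj v₂ v₃ := fun h =>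
    hB4 ⟨v₁, v₃, v₂, v₄, n12, n34, b13, h.symm, b24, b41, hb12, hb34⟩
  have b15_of_b45 : B.Adj v₄ v₅ → B.Adj v₁ v₅ := fun h => by
    by_contra h15
    exact hB4 ⟨v₁, v₃, v₅, v₄, n15, n34, b13, b35, h.symm, b41, h15, hb34⟩
  have b45_of_b15 : B.Adj v₁ v₅ → B.Adj v₄ v₅ := fun h => by
    by_contra h45'
    exact hB4 ⟨v₁, v₅, v₂, v₄, n12, n45.symm, h, b52, b24, b41, hb12, fun h' => h45' h'.symm⟩
  have b15 : B.Adj v₁ v₅ := by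
    by_contra h15
    have b45 : ¬ B.Adj v₄ v₅ := fun h => h15 (b15_of_b45 h)
    have hinjB : Function.Injective ![v₁, v₃, v₅, v₂, v₄] := by
      intro i j hij
      fin_cases i <;> fin_cases j <;> simp_all
    have hinjR : Function.Injective ![v₁, v₂, v₃, v₄, v₅] := by
      intro i j hij
      fin_cases i <;> fin_cases j <;> simp_all
    have hrange : Set.range ![v₁, v₃, v₅, v₂, v₄] = Set.range ![v₁, v₂, v₃, v₄, v₅] := by
      ext x
      simp only [Matrix.range_cons, Matrix.range_empty, Set.mem_union, Set.mem_singleton_iff]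
      tauto
    refine hnoDouble ⟨_, hrange ▸ isInducedC5On_range hinjB b13 b35 b52 b24 b41 h15
      (fun h => b23 h.symm) (fun h => b45 h.symm) (fun h => hb12 h.symm)
      (fun h => hb34 h.symm), isInducedC5On_range hinjR h12 h23 h34 h45 h51 h13 h24 h35 h41 h52⟩
  have b45 := b45_of_b15 b15
  have hX : B.IsClique ({v₁, v₄, v₅} : Set V) := by
    simp [SimpleGraph.isClique_insert, b15, b45, b41.symm]
  have hY : R.IsClique ({v₂, v₃} : Set V) := by
    simp [SimpleGraph.isClique_insert, h23]
  refine ⟨⟨h23, b23⟩, b15, b45, hX, hY, _, _, hX, hY, ?_⟩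
  ext x
  simp only [Set.mem_union, Set.mem_insert_iff, Set.mem_singleton_iff]
  tauto
end

section
/- Let B and R be C4-free simple graphs on the same finite vertex set V with G(B,R) the complete graph on V, and let v1, v2, v3, v4, v5 be a double C5 with blue edges and red diagonals. Let M be the set of vertices p ∈ V \ {v1,...,v5} that are B-adjacent to all of v1,...,v5, and let N be the set of vertices p ∈ V \ {v1,...,v5} that are R-adjacent to all of v1,...,v5. Then M is a clique of B and N is a clique of R. -/
/-- In a `C4`-free graph, the common neighbours of two distinct non-adjacent vertices form
a clique. -/
theorem IsC4Free.isClique_of_forall_adj {V : Type*} {G : SimpleGraph V} (hG : IsC4Free G)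
    {x y : V} (hxy : x ≠ y) (hnadj : ¬ G.Adj x y) {S : Set V}
    (hx : ∀ p ∈ S, G.Adj p x) (hy : ∀ p ∈ S, G.Adj p y) : G.IsClique S := by
  intro p hp q hq hpq
  by_contra hnpq
  exact hG ⟨p, x, q, y, hpq, hxy, hx p hp, (hx q hq).symm, hy q hq, (hy p hp).symm,
    hnpq, hnadj⟩

theorem stmt_14 {V : Type*} [Fintype V] (B R : SimpleGraph V)
    (hB4 : IsC4Free B) (hR4 : IsC4Free R)
    (hcomplete : B ⊔ R = ⊤)
    -- a double C5 with blue edges and red diagonals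
    (v : Fin 5 → V) (hv : Function.Injective v)
    (hblue : ∀ i, B.Adj (v i) (v (i + 1)) ∧ ¬ R.Adj (v i) (v (i + 1)))
    (hred : ∀ i, R.Adj (v i) (v (i + 2)) ∧ ¬ B.Adj (v i) (v (i + 2)))
    (M : Set V)
    (hM : M = {p : V | p ∉ Set.range v ∧ ∀ i, B.Adj p (v i)})
    (N : Set V)
    (hN : N = {p : V | p ∉ Set.range v ∧ ∀ i, R.Adj p (v i)}) :
    B.IsClique M ∧ R.IsClique N := by
  subst hM hN
  exact ⟨hB4.isClique_of_forall_adj (hred 0).1.ne (hred 0).2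
      (fun _ hp => hp.2 _) (fun _ hp => hp.2 _),
    hR4.isClique_of_forall_adj (hblue 0).1.ne (hblue 0).2
      (fun _ hp => hp.2 _) (fun _ hp => hp.2 _)⟩
end

section
/- Let B and R be C4-free simple graphs on the same finite vertex set V with G(B,R) the complete graph on V, and let v1, v2, v3, v4, v5 be a double C5 with blue edges and red diagonals. For each index j (mod 5), let A_j be the set of vertices p ∈ V \ {v1,...,v5} such that pv_j is an edge of both B and R, p is adjacent in B but not in R to v_{j-1} and v_{j+1}, and p is adjacent in R but not in B to v_{j-2} and v_{j+2}. Then each A_j is a clique in both B and R. -/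
/-- In a `C4`-free graph, the common neighbours of two distinct nonadjacent vertices are pairwise
adjacent. -/
theorem IsC4Free.adj_of_common_neighbors {V : Type*} {G : SimpleGraph V} (hG : IsC4Free G)
    {x y p q : V} (hxy : x ≠ y) (hnxy : ¬ G.Adj x y) (hpq : p ≠ q)
    (hpx : G.Adj p x) (hpy : G.Adj p y) (hqx : G.Adj q x) (hqy : G.Adj q y) : G.Adj p q := by
  by_contra h
  exact hG ⟨p, x, q, y, hpq, hxy, hpx, hqx.symm, hqy, hpy.symm, h, hnxy⟩

theorem stmt_15 {V : Type*} [Fintype V] (B R : SimpleGraph V)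
    (hB4 : IsC4Free B) (hR4 : IsC4Free R)
    (hcomplete : B ⊔ R = ⊤)
    -- a double C5 with blue edges and red diagonals
    (v : Fin 5 → V) (hv : Function.Injective v)
    (hblue : ∀ i, B.Adj (v i) (v (i + 1)) ∧ ¬ R.Adj (v i) (v (i + 1)))
    (hred : ∀ i, R.Adj (v i) (v (i + 2)) ∧ ¬ B.Adj (v i) (v (i + 2)))
    (A : Fin 5 → Set V)
    (hA : ∀ j, A j = {p : V | p ∉ Set.range v ∧
      B.Adj p (v j) ∧ R.Adj p (v j) ∧
      (B.Adj p (v (j + 1)) ∧ ¬ R.Adj p (v (j + 1))) ∧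
      (B.Adj p (v (j - 1)) ∧ ¬ R.Adj p (v (j - 1))) ∧
      (R.Adj p (v (j + 2)) ∧ ¬ B.Adj p (v (j + 2))) ∧
      (R.Adj p (v (j - 2)) ∧ ¬ B.Adj p (v (j - 2)))}) :
    ∀ j, B.IsClique (A j) ∧ R.IsClique (A j) := by
  intro j
  have hj : j - 1 + 2 = j + 1 := by revert j; decide
  have hj' : j + 2 + 1 = j - 2 := by revert j; decide
  have hr := hred (j - 1)
  have hb := hblue (j + 2)
  rw [hj] at hr
  rw [hj'] at hb
  rw [hA j]
  constructor
  · rintro p ⟨-, -, -, hp₁, hp₂, -, -⟩ q ⟨-, -, -, hq₁, hq₂, -, -⟩ hpq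
    exact hB4.adj_of_common_neighbors hr.1.ne hr.2 hpq hp₂.1 hp₁.1 hq₂.1 hq₁.1
  · rintro p ⟨-, -, -, -, -, hp₁, hp₂⟩ q ⟨-, -, -, -, -, hq₁, hq₂⟩ hpq
    exact hR4.adj_of_common_neighbors hb.1.ne hb.2 hpq hp₁.1 hp₂.1 hq₁.1 hq₂.1
end

section
/- Let B and R be C4-free simple graphs on the same finite vertex set V with G(B,R) the complete graph on V, and let v1, v2, v3, v4, v5 be a double C5 with blue edges and red diagonals. Suppose x1 ∈ V \ {v1,...,v5} satisfies: x1v1 is an edge of both B and R, x1 is adjacent in B but not in R to v2 and v5, and adjacent in R but not in B to v3 and v4; and suppose x2 ∈ V \ {v1,...,v5} satisfies: x2v2 is an edge of both B and R, x2 is adjacent in B but not in R to v1 and v3, and adjacent in R but not in B to v4 and v5. If x1 ≠ x2, then x1 and x2 are adjacent in B. -/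
theorem stmt_16 {V : Type*} [Fintype V] (B R : SimpleGraph V)
    (hB4 : IsC4Free B) (hR4 : IsC4Free R)
    (hcomplete : B ⊔ R = ⊤)
    -- a double C5 with blue edges and red diagonals
    (v : Fin 5 → V) (hv : Function.Injective v)
    (hblue : ∀ i, B.Adj (v i) (v (i + 1)) ∧ ¬ R.Adj (v i) (v (i + 1)))
    (hred : ∀ i, R.Adj (v i) (v (i + 2)) ∧ ¬ B.Adj (v i) (v (i + 2)))
    (x₁ : V) (hx₁ : x₁ ∉ Set.range v)
    (hx₁v : B.Adj x₁ (v 0) ∧ R.Adj x₁ (v 0) ∧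
      (B.Adj x₁ (v 1) ∧ ¬ R.Adj x₁ (v 1)) ∧
      (B.Adj x₁ (v 4) ∧ ¬ R.Adj x₁ (v 4)) ∧
      (R.Adj x₁ (v 2) ∧ ¬ B.Adj x₁ (v 2)) ∧
      (R.Adj x₁ (v 3) ∧ ¬ B.Adj x₁ (v 3)))
    (x₂ : V) (hx₂ : x₂ ∉ Set.range v)
    (hx₂v : B.Adj x₂ (v 1) ∧ R.Adj x₂ (v 1) ∧
      (B.Adj x₂ (v 0) ∧ ¬ R.Adj x₂ (v 0)) ∧
      (B.Adj x₂ (v 2) ∧ ¬ R.Adj x₂ (v 2)) ∧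
      (R.Adj x₂ (v 3) ∧ ¬ B.Adj x₂ (v 3)) ∧
      (R.Adj x₂ (v 4) ∧ ¬ B.Adj x₂ (v 4)))
    (hne : x₁ ≠ x₂) :
    B.Adj x₁ x₂ := by
  by_contra hB
  have hR : R.Adj x₁ x₂ := by
    have h : (B ⊔ R).Adj x₁ x₂ := by rw [hcomplete]; exact hne
    exact h.resolve_left hB
  obtain ⟨-, -, -, ⟨-, h₁₄⟩, ⟨h₁₂, -⟩, -⟩ := hx₁v
  obtain ⟨-, -, -, ⟨-, h₂₂⟩, -, h₂₄, -⟩ := hx₂v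
  exact hR4 ⟨x₁, x₂, v 4, v 2, fun h => hx₁ ⟨4, h.symm⟩, fun h => hx₂ ⟨2, h.symm⟩,
    hR, h₂₄, (hred 2).1.symm, h₁₂.symm, h₁₄, h₂₂⟩
end

section
/- Let B and R be C4-free simple graphs on the same finite vertex set V with G(B,R) the complete graph on V, and let v1, v2, v3, v4, v5 be a double C5 with blue edges and red diagonals. Let M be the set of vertices p ∈ V \ {v1,...,v5} that are B-adjacent to all of v1,...,v5, and for each index j (mod 5), let A_j be the set of vertices p ∈ V \ {v1,...,v5} such that pv_j is an edge of both B and R, p is adjacent in B but not in R to v_{j-1} and v_{j+1}, and p is adjacent in R but not in B to v_{j-2} and v_{j+2}. Then M ∪ A_1 ∪ A_2 ∪ {v1, v2} is a clique of B. -/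
/-- In a `C4`-free graph, two common neighbours of a nonadjacent pair are equal or adjacent. -/
theorem IsC4Free.adj_of_common_neighbors_s17 {V : Type*} {G : SimpleGraph V} (hG : IsC4Free G)
    {p q a b : V} (hpq : p ≠ q) (hab : a ≠ b) (hnab : ¬ G.Adj a b)
    (hpa : G.Adj p a) (hpb : G.Adj p b) (hqa : G.Adj q a) (hqb : G.Adj q b) : G.Adj p q := by
  by_contra h
  exact hG ⟨p, a, q, b, hpq, hab, hpa, hqa.symm, hqb, hpb.symm, h, hnab⟩

theorem stmt_17 {V : Type*} [Fintype V] (B R : SimpleGraph V)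
    (hB4 : IsC4Free B) (hR4 : IsC4Free R)
    (hcomplete : B ⊔ R = ⊤)
    -- a double C5 with blue edges and red diagonals
    (v : Fin 5 → V) (hv : Function.Injective v)
    (hblue : ∀ i, B.Adj (v i) (v (i + 1)) ∧ ¬ R.Adj (v i) (v (i + 1)))
    (hred : ∀ i, R.Adj (v i) (v (i + 2)) ∧ ¬ B.Adj (v i) (v (i + 2)))
    (M : Set V)
    (hM : M = {p : V | p ∉ Set.range v ∧ ∀ i, B.Adj p (v i)})
    (A : Fin 5 → Set V)
    (hA : ∀ j, A j = {p : V | p ∉ Set.range v ∧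
      B.Adj p (v j) ∧ R.Adj p (v j) ∧
      (B.Adj p (v (j + 1)) ∧ ¬ R.Adj p (v (j + 1))) ∧
      (B.Adj p (v (j - 1)) ∧ ¬ R.Adj p (v (j - 1))) ∧
      (R.Adj p (v (j + 2)) ∧ ¬ B.Adj p (v (j + 2))) ∧
      (R.Adj p (v (j - 2)) ∧ ¬ B.Adj p (v (j - 2)))}) :
    B.IsClique (M ∪ A 0 ∪ A 1 ∪ {v 0, v 1}) := by
  have hne : ∀ i, v i ≠ v (i + 2) := fun i => (hred i).1.ne
  have h14 : v 1 ≠ v 4 ∧ ¬ B.Adj (v 1) (v 4) := ⟨(hne 4).symm, fun h => (hred 4).2 h.symm⟩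
  have h02 : v 0 ≠ v 2 ∧ ¬ B.Adj (v 0) (v 2) := ⟨hne 0, (hred 0).2⟩
  have h01 : B.Adj (v 0) (v 1) := (hblue 0).1
  have h24 : R.Adj (v 2) (v 4) := (hred 2).1
  have hMv : ∀ p ∈ M, ∀ i, B.Adj p (v i) := by
    intro p hp
    rw [hM] at hp
    exact hp.2
  have hA0 : ∀ p ∈ A 0, B.Adj p (v 0) ∧ B.Adj p (v 1) ∧ B.Adj p (v 4) ∧
      ¬ R.Adj p (v 4) ∧ R.Adj p (v 2) := by
    intro p hp
    rw [hA] at hp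
    obtain ⟨-, h0, -, ⟨h1, -⟩, ⟨h4, h4'⟩, ⟨h2, -⟩, -⟩ := hp
    exact ⟨h0, h1, h4, h4', h2⟩
  have hA1 : ∀ p ∈ A 1, B.Adj p (v 0) ∧ B.Adj p (v 1) ∧ B.Adj p (v 2) ∧
      ¬ R.Adj p (v 2) ∧ R.Adj p (v 4) := by
    intro p hp
    rw [hA] at hp
    obtain ⟨-, h1, -, ⟨h2, h2'⟩, ⟨h0, -⟩, -, ⟨h4, -⟩⟩ := hp
    exact ⟨h0, h1, h2, h2', h4⟩
  have hA01 : ∀ p ∈ A 0, ∀ q ∈ A 1, p ≠ q → B.Adj p q := by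
    intro p hp q hq hpq
    obtain ⟨-, -, hp4, hp4', hp2⟩ := hA0 p hp
    obtain ⟨-, -, hq2, hq2', hq4⟩ := hA1 q hq
    have hsup : (B ⊔ R).Adj p q := by simpa [hcomplete] using hpq
    exact hsup.resolve_right fun h =>
      hR4 ⟨p, q, v 4, v 2, hp4.ne, hq2.ne, h, hq4, h24.symm, hp2.symm, hp4', hq2'⟩
  have common14 : ∀ p q, p ≠ q → B.Adj p (v 1) → B.Adj p (v 4) → B.Adj q (v 1) →
      B.Adj q (v 4) → B.Adj p q := fun _ _ hpq =>
    hB4.adj_of_common_neighbors_s17 hpq h14.1 h14.2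
  have common02 : ∀ p q, p ≠ q → B.Adj p (v 0) → B.Adj p (v 2) → B.Adj q (v 0) →
      B.Adj q (v 2) → B.Adj p q := fun _ _ hpq =>
    hB4.adj_of_common_neighbors_s17 hpq h02.1 h02.2
  intro p hp q hq hpq
  simp only [Set.mem_union, Set.mem_insert_iff, Set.mem_singleton_iff] at hp hq
  grind [SimpleGraph.adj_comm]
end
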